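/- Asymptotically almost surely the following holds in D(n, m_Z): there exist a set T ⊆ W with |T| = n − 1, a vertex u ∈ V, and a bijection f : V ∖ {u} → T such that every v ≠ u has an edge of D(n, m_Z) with head v of colour f(v), and moreover D(n, m_Z) contains a rainbow arborescence rooted at u with at least ⌈n^{2/3}⌉ vertices, all of whose edge colours lie outside T. -/

import Mathlib

open Filter

/-- The directed edges of the complete digraph on `Fin n`:
ordered pairs `(tail, head)` of distinct vertices. -/
abbrev DEdge (n : ℕ) := {e : Fin n × Fin n // e.1 ≠ e.2}

/-- `ε(n) = log log n / log n`. -/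
noncomputable def eps (n : ℕ) : ℝ := Real.log (Real.log n) / Real.log n

/-- The number of available colours: `⌊(1 + 50 ε) n⌋`. -/
noncomputable def numColours (n : ℕ) : ℕ := ⌊(1 + 50 * eps n) * n⌋₊

/-- The set of colours `W`. -/
abbrev Colour (n : ℕ) := Fin (numColours n)

/-- The sample space of the coloured random digraph process: a uniformly random
permutation of the edges (determining the random ordering `e₁, …, e_N`) together
with a uniformly random colouring of the edges. -/
abbrev SampleSpace (n : ℕ) := Equiv.Perm (DEdge n) × (DEdge n → Colour n)

/-- The (0-indexed) position of edge `e` in the random ordering determined by `ω`. -/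
noncomputable def edgePos {n : ℕ} (ω : SampleSpace n) (e : DEdge n) : ℕ :=
  ((Fintype.equivFin (DEdge n)) (ω.1 e)).val

/-- `e` is one of the first `m` edges of the process, i.e. an edge of `D(n,m)`. -/
def inProcess {n : ℕ} (ω : SampleSpace n) (m : ℕ) (e : DEdge n) : Prop :=
  edgePos ω e < m

/-- The probability of an event under the uniform measure on a finite sample space. -/
noncomputable def prob {Ω : Type*} [Fintype Ω] (p : Ω → Prop) : ℝ :=
  (Nat.card {ω : Ω // p ω} : ℝ) / (Fintype.card Ω : ℝ)

/-- Vertex `v` has in-degree zero in `D(n,m)`. -/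
def InDegreeZero {n : ℕ} (ω : SampleSpace n) (m : ℕ) (v : Fin n) : Prop :=
  ∀ e : DEdge n, inProcess ω m e → e.val.2 ≠ v

/-- The event `Z_m`: at most one vertex of `D(n,m)` has in-degree zero. -/
def ZEvent {n : ℕ} (ω : SampleSpace n) (m : ℕ) : Prop :=
  Set.Subsingleton {v : Fin n | InDegreeZero ω m v}

/-- `A` is the edge set of a spanning arborescence rooted at `u`: the root has no
in-edge, every other vertex has exactly one in-edge, and every vertex is reachable
from the root along edges of `A` (equivalently, for every vertex `v` there is
exactly one directed path from `u` to `v`). -/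
def IsSpanningArborescence {n : ℕ} (A : Set (DEdge n)) (u : Fin n) : Prop :=
  (∀ e ∈ A, (e : DEdge n).val.2 ≠ u) ∧
  (∀ v : Fin n, v ≠ u → ∃! e : DEdge n, e ∈ A ∧ e.val.2 = v) ∧
  (∀ v : Fin n, Relation.ReflTransGen (fun x y => ∃ e ∈ A, (e : DEdge n).val = (x, y)) u v)

/-- The event `A_m`: `D(n,m)` contains a spanning arborescence. -/
def AEvent {n : ℕ} (ω : SampleSpace n) (m : ℕ) : Prop :=
  ∃ (u : Fin n) (A : Set (DEdge n)), (∀ e ∈ A, inProcess ω m e) ∧ IsSpanningArborescence A u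

/-- The event `R_m`: `D(n,m)` contains a rainbow spanning arborescence. -/
def REvent {n : ℕ} (ω : SampleSpace n) (m : ℕ) : Prop :=
  ∃ (u : Fin n) (A : Set (DEdge n)), (∀ e ∈ A, inProcess ω m e) ∧
    IsSpanningArborescence A u ∧ Set.InjOn ω.2 A

/-- The hitting time `min {m : P m}`, with the convention `min ∅ = N = n(n-1)`. -/
noncomputable def hitTime (n : ℕ) (P : ℕ → Prop) : ℕ :=
  sInf ({m | P m} ∪ {n * (n - 1)})

/-- `A` is the edge set of a (not necessarily spanning) arborescence rooted at `u`:
`u` has no in-edge in `A`, every head of an edge of `A` has exactly one in-edge in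
`A`, and every head of an edge of `A` is reachable from `u` along edges of `A`.
Its vertex set is `{u}` together with the heads of its edges. -/
def IsArborescenceRootedAt {n : ℕ} (A : Set (DEdge n)) (u : Fin n) : Prop :=
  (∀ e ∈ A, (e : DEdge n).val.2 ≠ u) ∧
  (∀ v : Fin n, (∃ e ∈ A, (e : DEdge n).val.2 = v) →
    ∃! e : DEdge n, e ∈ A ∧ e.val.2 = v) ∧
  (∀ e ∈ A, Relation.ReflTransGen
    (fun x y => ∃ e' ∈ A, (e' : DEdge n).val = (x, y)) u (e : DEdge n).val.2)

section Averages

variable {Ω : Type*} [Fintype Ω]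

/-- The expectation of `f` under the uniform measure on a finite type. -/
noncomputable def avg (f : Ω → ℝ) : ℝ := (∑ ω, f ω) / (Fintype.card Ω : ℝ)

open Classical in
lemma prob_eq_avg (p : Ω → Prop) : prob p = avg (fun ω => if p ω then (1 : ℝ) else 0) := by
  unfold prob avg
  rw [Nat.card_eq_fintype_card, Fintype.card_subtype, Finset.sum_boole]

lemma avg_mono {f g : Ω → ℝ} (h : ∀ ω, f ω ≤ g ω) : avg f ≤ avg g := by
  unfold avg
  gcongr with ω
  exact h ω

lemma avg_sum {ι : Type*} (s : Finset ι) (f : ι → Ω → ℝ) :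
    avg (fun ω => ∑ i ∈ s, f i ω) = ∑ i ∈ s, avg (f i) := by
  unfold avg
  rw [Finset.sum_comm, Finset.sum_div]

lemma avg_const_mul (c : ℝ) (f : Ω → ℝ) : avg (fun ω => c * f ω) = c * avg f := by
  unfold avg
  rw [← Finset.mul_sum, mul_div_assoc]

lemma avg_const [Nonempty Ω] (c : ℝ) : avg (fun _ : Ω => c) = c := by
  unfold avg
  have : (Fintype.card Ω : ℝ) ≠ 0 := by exact_mod_cast Fintype.card_ne_zero
  simp [this]

lemma avg_prod {Ω' : Type*} [Fintype Ω'] (f : Ω × Ω' → ℝ) :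
    avg f = avg (fun a => avg (fun b => f (a, b))) := by
  unfold avg
  rw [Fintype.sum_prod_type, Fintype.card_prod, ← Finset.sum_div, div_div, Nat.cast_mul, mul_comm]

lemma prob_nonneg (p : Ω → Prop) : 0 ≤ prob p := by unfold prob; positivity

lemma prob_le_one (p : Ω → Prop) : prob p ≤ 1 := by
  unfold prob
  refine div_le_one_of_le₀ ?_ (Nat.cast_nonneg _)
  rw [← Nat.card_eq_fintype_card]
  exact_mod_cast Nat.card_le_card_of_injective _ Subtype.val_injective

lemma prob_mono {p q : Ω → Prop} (h : ∀ ω, p ω → q ω) : prob p ≤ prob q := by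
  classical
  rw [prob_eq_avg, prob_eq_avg]
  refine avg_mono fun ω => ?_
  by_cases hp : p ω
  · simp [hp, h ω hp]
  · simp only [hp, if_false]
    split_ifs <;> norm_num

lemma prob_exists_le {ι : Type*} (s : Finset ι) (p : ι → Ω → Prop) :
    prob (fun ω => ∃ i ∈ s, p i ω) ≤ ∑ i ∈ s, prob (p i) := by
  classical
  simp_rw [prob_eq_avg]
  rw [← avg_sum]
  refine avg_mono fun ω => ?_
  have hnn : ∀ i ∈ s, (0 : ℝ) ≤ if p i ω then 1 else 0 := fun i _ => by split_ifs <;> norm_num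
  split_ifs with h
  · obtain ⟨i, hi, hp⟩ := h
    exact le_trans (by simp [hp]) (Finset.single_le_sum hnn hi)
  · exact Finset.sum_nonneg hnn

lemma prob_or_le (p q : Ω → Prop) : prob (fun ω => p ω ∨ q ω) ≤ prob p + prob q := by
  classical
  simp_rw [prob_eq_avg]
  unfold avg
  rw [← add_div, ← Finset.sum_add_distrib]
  gcongr with ω
  by_cases hp : p ω <;> by_cases hq : q ω <;> simp [hp, hq]

lemma one_sub_prob_not_le [Nonempty Ω] (p : Ω → Prop) : 1 - prob (fun ω => ¬ p ω) ≤ prob p := by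
  have h := prob_or_le p (fun ω => ¬ p ω)
  have h1 : prob (fun ω => p ω ∨ ¬ p ω) = 1 := by
    rw [prob_eq_avg]
    simp [em, avg_const]
  linarith

lemma prob_comp_equiv (φ : Ω ≃ Ω) (p : Ω → Prop) : prob (fun ω => p (φ ω)) = prob p := by
  classical
  simp_rw [prob_eq_avg, avg]
  rw [Equiv.sum_comp φ (fun ω => if p ω then (1 : ℝ) else 0)]

/-- Markov's inequality. -/
lemma prob_lt_le_avg_div {f : Ω → ℝ} (hf : ∀ ω, 0 ≤ f ω) {c : ℝ} (hc : 0 < c) :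
    prob (fun ω => c < f ω) ≤ avg f / c := by
  classical
  rw [prob_eq_avg, div_eq_inv_mul, ← avg_const_mul]
  refine avg_mono fun ω => ?_
  split_ifs with h
  · rw [inv_mul_eq_div, one_le_div hc]
    exact h.le
  · have := hf ω
    positivity

/-- An event on a product space is at most as likely as the average of any bound on its
conditional probability. -/
lemma prob_prod_le {Ω' : Type*} [Fintype Ω'] (p : Ω × Ω' → Prop) (f : Ω → ℝ)
    (h : ∀ a, prob (fun b => p (a, b)) ≤ f a) : prob p ≤ avg f := by
  classical
  rw [prob_eq_avg, avg_prod]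
  refine avg_mono fun a => ?_
  have := h a
  rwa [prob_eq_avg] at this

/-- An event determined by the first coordinate. -/
lemma prob_fst_le {Ω' : Type*} [Fintype Ω'] (p : Ω → Prop) :
    prob (fun ω : Ω × Ω' => p ω.1) ≤ prob p := by
  classical
  rw [prob_eq_avg p]
  refine prob_prod_le _ _ fun a => ?_
  split_ifs with h
  · exact prob_le_one _
  · simp [prob, h]

end Averages

section Permutations

lemma mul_swap_apply_of_notMem {α : Type*} [DecidableEq α] {s : Finset α} {e e' x : α} (he : e ∉ s)
    (he' : e' ∉ s)
    (hx : x ∈ s) (σ : Equiv.Perm α) : (σ * Equiv.swap e e') x = σ x := by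
  rw [Equiv.Perm.mul_apply, Equiv.swap_apply_of_ne_of_ne]
  · rintro rfl; exact he hx
  · rintro rfl; exact he' hx

variable {α : Type*} [Fintype α] [DecidableEq α]

/-- The probability that a uniformly random permutation maps `A` into `M` and `B` into the
complement of `M`. -/
noncomputable def sepProb (M A B : Finset α) : ℝ :=
  prob (fun σ : Equiv.Perm α => (∀ e ∈ A, σ e ∈ M) ∧ ∀ e ∈ B, σ e ∉ M)

lemma sepProb_nonneg (M A B : Finset α) : 0 ≤ sepProb M A B := prob_nonneg _

lemma sepProb_insert_left_eq (M A B : Finset α) {e e' : α} (heA : e ∉ A) (heB : e ∉ B)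
    (heA' : e' ∉ A) (heB' : e' ∉ B) : sepProb M (insert e A) B = sepProb M (insert e' A) B := by
  unfold sepProb
  rw [← prob_comp_equiv (Equiv.mulRight (Equiv.swap e e'))]
  congr 1
  funext σ
  simp only [Equiv.coe_mulRight, Finset.forall_mem_insert]
  have hA : (∀ x ∈ A, (σ * Equiv.swap e e') x ∈ M) ↔ ∀ x ∈ A, σ x ∈ M :=
    forall₂_congr fun x hx => by rw [mul_swap_apply_of_notMem heA heA' hx]
  have hB : (∀ x ∈ B, (σ * Equiv.swap e e') x ∉ M) ↔ ∀ x ∈ B, σ x ∉ M :=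
    forall₂_congr fun x hx => by rw [mul_swap_apply_of_notMem heB heB' hx]
  rw [hA, hB]
  simp

lemma card_filter_apply_mem (M : Finset α) (σ : Equiv.Perm α) :
    (Finset.univ.filter fun x => σ x ∈ M).card = M.card := by
  rw [← Finset.card_map σ.toEmbedding]
  congr 1
  ext x
  simp only [Finset.mem_map, Finset.mem_filter, Finset.mem_univ, true_and]
  constructor
  · rintro ⟨y, hy, rfl⟩; exact hy
  · intro hx; exact ⟨σ.symm x, by simpa using hx, by simp⟩

lemma card_filter_compl_apply_mem (M A B : Finset α) (σ : Equiv.Perm α)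
    (hA : ∀ e ∈ A, σ e ∈ M) (hB : ∀ e ∈ B, σ e ∉ M) :
    ((((A ∪ B)ᶜ).filter fun x => σ x ∈ M).card : ℝ) = (M.card : ℝ) - A.card := by
  have h : Finset.univ.filter (fun x => σ x ∈ M) = A ∪ ((A ∪ B)ᶜ).filter fun x => σ x ∈ M := by
    ext x
    by_cases hxA : x ∈ A
    · simp [hxA, hA x hxA]
    · by_cases hxB : x ∈ B
      · simp [hxB, hxA, hB x hxB]
      · simp [hxA, hxB]
  rw [← card_filter_apply_mem M σ, h, Finset.card_union_of_disjoint]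
  · push_cast; ring
  · rw [Finset.disjoint_left]
    intro x hx hx'
    simp [hx] at hx'

lemma card_compl_union (A B : Finset α) (hAB : Disjoint A B) :
    (((A ∪ B)ᶜ).card : ℝ) = (Fintype.card α : ℝ) - A.card - B.card := by
  rw [Finset.card_compl, Nat.cast_sub (Finset.card_le_univ _), Finset.card_union_of_disjoint hAB]
  push_cast; ring

lemma sepProb_insert_left (M A B : Finset α) (hAB : Disjoint A B) {e : α} (heA : e ∉ A)
    (heB : e ∉ B) :
    sepProb M (insert e A) B * ((Fintype.card α : ℝ) - A.card - B.card) =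
      sepProb M A B * ((M.card : ℝ) - A.card) := by
  classical
  rw [← card_compl_union A B hAB]
  have h : ∑ x ∈ (A ∪ B)ᶜ, sepProb M (insert x A) B =
      sepProb M (insert e A) B * ((A ∪ B)ᶜ).card := by
    rw [Finset.sum_congr rfl (g := fun _ => sepProb M (insert e A) B), Finset.sum_const,
      nsmul_eq_mul, mul_comm]
    intro x hx
    simp only [Finset.mem_compl, Finset.mem_union, not_or] at hx
    exact sepProb_insert_left_eq M A B hx.1 hx.2 heA heB
  rw [← h]
  unfold sepProb
  simp_rw [prob_eq_avg]
  rw [← avg_sum, mul_comm, ← avg_const_mul]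
  congr 1
  funext σ
  split_ifs with hσ
  · rw [mul_one, ← card_filter_compl_apply_mem M A B σ hσ.1 hσ.2, Finset.card_filter]
    push_cast
    refine Finset.sum_congr rfl fun x _ => ?_
    by_cases hx : σ x ∈ M
    · rw [if_pos hx, if_pos ⟨Finset.forall_mem_insert .. |>.2 ⟨hx, hσ.1⟩, hσ.2⟩]
    · rw [if_neg hx, if_neg fun h => hx (h.1 x (Finset.mem_insert_self x A))]
  · rw [mul_zero]
    refine Finset.sum_eq_zero fun x _ => if_neg fun hx => hσ ⟨fun e he => hx.1 e ?_, hx.2⟩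
    exact Finset.mem_insert_of_mem he

lemma sepProb_insert_right (M A B : Finset α) (hAB : Disjoint A B) {e : α} (heA : e ∉ A)
    (heB : e ∉ B) :
    sepProb M A (insert e B) * ((Fintype.card α : ℝ) - A.card - B.card) =
      sepProb M A B * ((Fintype.card α : ℝ) - M.card - B.card) := by
  classical
  have h1 : sepProb M A (insert e B) = sepProb M A B - sepProb M (insert e A) B := by
    unfold sepProb
    simp_rw [prob_eq_avg, avg]
    rw [← sub_div, ← Finset.sum_sub_distrib]
    congr 2
    funext σ
    simp only [Finset.forall_mem_insert]
    by_cases h : (∀ e ∈ A, σ e ∈ M) ∧ ∀ e ∈ B, σ e ∉ M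
    · by_cases h' : σ e ∈ M
      · rw [if_neg (by tauto), if_pos h, if_pos (by tauto)]; norm_num
      · rw [if_pos (by tauto), if_pos h, if_neg (by tauto)]; norm_num
    · rw [if_neg (by tauto), if_neg h, if_neg (by tauto)]; norm_num
  rw [h1, sub_mul, sepProb_insert_left M A B hAB heA heB]
  ring

lemma sepProb_empty (M : Finset α) : sepProb M ∅ ∅ = 1 := by
  unfold sepProb
  simp [prob_eq_avg, avg_const]

lemma sepProb_left_le (M A : Finset α) :
    sepProb M A ∅ ≤ ((M.card : ℝ) / Fintype.card α) ^ A.card := by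
  induction A using Finset.induction_on with
  | empty => simp [sepProb_empty]
  | insert e A he ih =>
    rw [Finset.card_insert_of_notMem he, pow_succ]
    have h := sepProb_insert_left M A ∅ (by simp) he (by simp)
    have hlt : A.card < Fintype.card α := by
      rw [← Finset.card_univ]
      exact Finset.card_lt_card ⟨Finset.subset_univ _, fun h => he (h (Finset.mem_univ e))⟩
    have hlt' : (A.card : ℝ) < Fintype.card α := by exact_mod_cast hlt
    have hM : (M.card : ℝ) ≤ Fintype.card α := by exact_mod_cast Finset.card_le_univ M
    have hA0 : (0 : ℝ) ≤ A.card := Nat.cast_nonneg _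
    have hM0 : (0 : ℝ) ≤ M.card := Nat.cast_nonneg _
    simp only [Finset.card_empty, Nat.cast_zero, sub_zero] at h
    have hpos : (0 : ℝ) < Fintype.card α - A.card := by linarith
    rw [eq_comm, ← div_eq_iff hpos.ne'] at h
    rw [← h, mul_div_assoc]
    have hr : ((M.card : ℝ) - A.card) / (Fintype.card α - A.card) ≤ M.card / Fintype.card α := by
      rw [div_le_div_iff₀ hpos (by linarith)]
      nlinarith
    calc _ ≤ sepProb M A ∅ * (M.card / Fintype.card α) :=
          mul_le_mul_of_nonneg_left hr (sepProb_nonneg _ _ _)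
      _ ≤ _ := mul_le_mul_of_nonneg_right ih (by positivity)

lemma sepProb_le (M A B : Finset α) (hAB : Disjoint A B) (hAM : A.card ≤ M.card) :
    sepProb M A B ≤ ((M.card : ℝ) / Fintype.card α) ^ A.card *
      (1 - ((M.card : ℝ) - A.card) / Fintype.card α) ^ B.card := by
  induction B using Finset.induction_on with
  | empty => simpa using sepProb_left_le M A
  | insert e B he ih =>
    rw [Finset.disjoint_insert_right] at hAB
    rw [Finset.card_insert_of_notMem he, pow_succ, ← mul_assoc]
    have h := sepProb_insert_right M A B hAB.2 hAB.1 he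
    have hlt : A.card + B.card < Fintype.card α := by
      rw [← Finset.card_univ, ← Finset.card_union_of_disjoint hAB.2]
      exact Finset.card_lt_card ⟨Finset.subset_univ _,
        fun h => (by simp [he, hAB.1] : e ∉ A ∪ B) (h (Finset.mem_univ e))⟩
    have hlt' : (A.card : ℝ) + B.card < Fintype.card α := by exact_mod_cast hlt
    have hM : (M.card : ℝ) ≤ Fintype.card α := by exact_mod_cast Finset.card_le_univ M
    have hA0 : (0 : ℝ) ≤ A.card := Nat.cast_nonneg _
    have hB0 : (0 : ℝ) ≤ B.card := Nat.cast_nonneg _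
    have hAM' : (A.card : ℝ) ≤ M.card := by exact_mod_cast hAM
    have hpos : (0 : ℝ) < Fintype.card α - A.card - B.card := by linarith
    have hN : (0 : ℝ) < Fintype.card α := by linarith
    rw [eq_comm, ← div_eq_iff hpos.ne'] at h
    rw [← h, mul_div_assoc]
    have hr : ((Fintype.card α : ℝ) - M.card - B.card) / (Fintype.card α - A.card - B.card) ≤
        1 - ((M.card : ℝ) - A.card) / Fintype.card α := by
      rw [div_le_iff₀ hpos, one_sub_div hN.ne', div_mul_eq_mul_div, le_div_iff₀ hN]
      nlinarith [mul_nonneg hB0 (sub_nonneg.2 hAM'), mul_nonneg hA0 (sub_nonneg.2 hAM')]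
    have h1 : 0 ≤ 1 - ((M.card : ℝ) - A.card) / Fintype.card α := by
      rw [sub_nonneg, div_le_one hN]; linarith
    calc _ ≤ sepProb M A B * (1 - ((M.card : ℝ) - A.card) / Fintype.card α) :=
          mul_le_mul_of_nonneg_left hr (sepProb_nonneg _ _ _)
      _ ≤ _ := mul_le_mul_of_nonneg_right (ih hAB.2) h1

/-- An exponential-moment bound for the random set `σ⁻¹ M`. -/
lemma avg_prod_weight_le (M A : Finset α) (hAM : A.card ≤ M.card) (r : α → ℝ)
    (hr0 : ∀ e, 0 ≤ r e) (hr1 : ∀ e, r e ≤ 1) :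
    avg (fun σ : Equiv.Perm α => (if ∀ e ∈ A, σ e ∈ M then (1 : ℝ) else 0) *
        ∏ e ∈ Aᶜ, (if σ e ∈ M then r e else 1)) ≤
      ((M.card : ℝ) / Fintype.card α) ^ A.card *
        Real.exp (-(((M.card : ℝ) - A.card) / Fintype.card α * ∑ e ∈ Aᶜ, (1 - r e))) := by
  set y : ℝ := ((M.card : ℝ) - A.card) / Fintype.card α with hy
  have hM : (M.card : ℝ) ≤ Fintype.card α := by exact_mod_cast Finset.card_le_univ M
  have hAM' : (A.card : ℝ) ≤ M.card := by exact_mod_cast hAM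
  have hA0 : (0 : ℝ) ≤ A.card := Nat.cast_nonneg _
  have hy1 : y ≤ 1 := div_le_one_of_le₀ (by linarith) (by linarith)
  have hexp : ∀ σ : Equiv.Perm α, (if ∀ e ∈ A, σ e ∈ M then (1 : ℝ) else 0) *
        ∏ e ∈ Aᶜ, (if σ e ∈ M then r e else 1) =
      ∑ B ∈ (Aᶜ).powerset, ((∏ e ∈ B, (1 - r e)) * ∏ e ∈ Aᶜ \ B, r e) *
        (if (∀ e ∈ A, σ e ∈ M) ∧ ∀ e ∈ B, σ e ∉ M then (1 : ℝ) else 0) := by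
    intro σ
    have h1 : ∀ e ∈ Aᶜ, (if σ e ∈ M then r e else 1) =
        (1 - r e) * (if σ e ∉ M then 1 else 0) + r e := by
      intro e _
      by_cases h : σ e ∈ M <;> simp [h]
    rw [Finset.prod_congr rfl h1, Finset.prod_add, Finset.mul_sum]
    refine Finset.sum_congr rfl fun B _ => ?_
    rw [Finset.prod_mul_distrib]
    have h2 : ∏ e ∈ B, (if σ e ∉ M then (1 : ℝ) else 0) =
        if ∀ e ∈ B, σ e ∉ M then 1 else 0 := by
      rw [Finset.prod_ite_zero]; simp
    rw [h2]
    rw [ite_and]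
    split_ifs <;> simp
  simp_rw [hexp]
  rw [avg_sum]
  calc _ ≤ ∑ B ∈ (Aᶜ).powerset, ((∏ e ∈ B, (1 - r e)) * ∏ e ∈ Aᶜ \ B, r e) *
        (((M.card : ℝ) / Fintype.card α) ^ A.card * (1 - y) ^ B.card) := by
        refine Finset.sum_le_sum fun B hB => ?_
        rw [avg_const_mul]
        refine mul_le_mul_of_nonneg_left ?_ ?_
        · have hd : Disjoint A B := by
            rw [Finset.mem_powerset] at hB
            exact Finset.disjoint_left.2 fun x hx hx' => by simpa [hx] using hB hx'
          have := sepProb_le M A B hd hAM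
          unfold sepProb at this
          rw [prob_eq_avg, ← hy] at this
          refine le_trans (le_of_eq ?_) this
          refine congrArg avg (funext fun σ => ?_)
          split_ifs <;> rfl
        · exact mul_nonneg (Finset.prod_nonneg fun e _ => sub_nonneg.2 (hr1 e))
            (Finset.prod_nonneg fun e _ => hr0 e)
    _ = ((M.card : ℝ) / Fintype.card α) ^ A.card * ∏ e ∈ Aᶜ, ((1 - r e) * (1 - y) + r e) := by
        rw [Finset.prod_add, Finset.mul_sum]
        refine Finset.sum_congr rfl fun B _ => ?_
        rw [Finset.prod_mul_distrib, Finset.prod_const]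
        ring
    _ ≤ _ := by
        refine mul_le_mul_of_nonneg_left ?_ (by positivity)
        rw [Finset.mul_sum, ← Finset.sum_neg_distrib, Real.exp_sum]
        refine Finset.prod_le_prod (fun e _ => ?_) fun e _ => ?_
        · exact add_nonneg (mul_nonneg (sub_nonneg.2 (hr1 e)) (sub_nonneg.2 hy1)) (hr0 e)
        · have := Real.add_one_le_exp (-(y * (1 - r e)))
          linarith

end Permutations

section Colourings

variable {E W : Type*} [Fintype E] [DecidableEq E] [Fintype W] [DecidableEq W]

/-- If the set `Φ g` of admissible colours depends only on the colours outside `M` and has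
at most `b` elements, then all of `M` gets admissible colours with probability at most
`(b / |W|) ^ |M|`. -/
lemma prob_forall_mem_le (M : Finset E) (Φ : (E → W) → Finset W) (b : ℕ)
    (hΦ : ∀ g g' : E → W, (∀ e ∉ M, g e = g' e) → Φ g = Φ g') (hb : ∀ g, (Φ g).card ≤ b) :
    prob (fun g : E → W => ∀ e ∈ M, g e ∈ Φ g) ≤ ((b : ℝ) / Fintype.card W) ^ M.card := by
  classical
  by_cases hW : Fintype.card W = 0
  · have : IsEmpty W := Fintype.card_eq_zero_iff.1 hW
    rcases M.eq_empty_or_nonempty with rfl | ⟨e, he⟩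
    · simpa using prob_le_one _
    · have : IsEmpty (E → W) := ⟨fun g => this.false (g e)⟩
      simp only [prob, Fintype.card_eq_zero, Nat.cast_zero, div_zero]
      positivity
  let eqv := Equiv.piEquivPiSubtypeProd (fun e => e ∈ M) (fun _ => W)
  have hcount : Nat.card {g : E → W // ∀ e ∈ M, g e ∈ Φ g} ≤
      b ^ M.card * Fintype.card ({e // ¬ e ∈ M} → W) := by
    rw [Nat.card_congr (Equiv.subtypeEquiv (q := fun x => ∀ e ∈ M, eqv.symm x e ∈ Φ (eqv.symm x))
      eqv (fun g => by simp)), Nat.card_eq_fintype_card, Fintype.card_subtype,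
      Finset.card_eq_sum_card_fiberwise (f := Prod.snd) (t := Finset.univ) (by simp)]
    calc _ ≤ ∑ _h : {e // ¬ e ∈ M} → W, b ^ M.card := by
          refine Finset.sum_le_sum fun h _ => ?_
          by_cases hne : Nonempty ({e // e ∈ M} → W)
          · obtain ⟨f₀⟩ := hne
            calc _ ≤ (Fintype.piFinset fun _ : {e // e ∈ M} => Φ (eqv.symm (f₀, h))).card := by
                  refine Finset.card_le_card_of_injOn Prod.fst ?_ ?_
                  · rintro ⟨f, h'⟩ hf
                    simp only [Finset.coe_filter, Finset.mem_filter, Finset.mem_univ, true_and,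
                      Set.mem_ofPred_eq] at hf
                    obtain ⟨hf, rfl⟩ := hf
                    simp only [Finset.mem_coe, Fintype.mem_piFinset]
                    intro e
                    have h1 := hf e e.2
                    rw [hΦ (eqv.symm (f₀, h')) (eqv.symm (f, h'))]
                    · simpa [eqv, Equiv.piEquivPiSubtypeProd] using h1
                    · intro e he
                      simp [eqv, Equiv.piEquivPiSubtypeProd, he]
                  · rintro ⟨f, h'⟩ hf ⟨f₁, h₁⟩ hf₁ heq
                    simp only [Finset.coe_filter, Finset.mem_filter, Finset.mem_univ, true_and,
                      Set.mem_ofPred_eq] at hf hf₁ heq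
                    rw [heq, hf.2, hf₁.2]
              _ = (Φ (eqv.symm (f₀, h))).card ^ M.card := by
                  simp [Fintype.card_piFinset]
              _ ≤ b ^ M.card := Nat.pow_le_pow_left (hb _) _
          · rw [not_nonempty_iff] at hne
            rw [Finset.card_eq_zero.2]
            · exact Nat.zero_le _
            · ext x
              exact (hne.false x.1).elim
      _ = _ := by simp [mul_comm]
  have hcard : (Fintype.card (E → W) : ℝ) =
      (Fintype.card W : ℝ) ^ M.card * Fintype.card ({e // ¬ e ∈ M} → W) := by
    rw [Fintype.card_congr eqv, Fintype.card_prod]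
    simp
  have hW' : (0 : ℝ) < Fintype.card W := by exact_mod_cast Nat.pos_of_ne_zero hW
  have hR : (0 : ℝ) < Fintype.card ({e // ¬ e ∈ M} → W) := by
    have : Nonempty W := Fintype.card_pos_iff.1 (Nat.pos_of_ne_zero hW)
    exact_mod_cast Fintype.card_pos
  unfold prob
  rw [hcard, div_pow, div_le_div_iff₀ (by positivity) (by positivity)]
  have : (Nat.card {g : E → W // ∀ e ∈ M, g e ∈ Φ g} : ℝ) ≤
      (b : ℝ) ^ M.card * Fintype.card ({e // ¬ e ∈ M} → W) := by exact_mod_cast hcount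
  calc _ ≤ (b : ℝ) ^ M.card * Fintype.card ({e // ¬ e ∈ M} → W) * (Fintype.card W : ℝ) ^ M.card :=
        mul_le_mul_of_nonneg_right this (by positivity)
    _ = _ := by ring

end Colourings

section HittingTime

variable {n : ℕ}

/-- The positions filled by the first `m` edges of the process. -/
noncomputable def earlyEdges (n m : ℕ) : Finset (DEdge n) :=
  Finset.univ.filter fun e => ((Fintype.equivFin (DEdge n)) e).val < m

lemma inProcess_iff (ω : SampleSpace n) (m : ℕ) (e : DEdge n) :
    inProcess ω m e ↔ ω.1 e ∈ earlyEdges n m := by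
  simp [inProcess, edgePos, earlyEdges]

lemma card_filter_snd_eq (v : Fin n) :
    (Finset.univ.filter fun e : DEdge n => e.val.2 = v).card = n - 1 := by
  have : (Finset.univ.filter fun e : DEdge n => e.val.2 = v).card =
      (Finset.univ.erase v : Finset (Fin n)).card := by
    refine Finset.card_bij (fun e _ => e.val.1) ?_ ?_ ?_
    · intro e he
      simp only [Finset.mem_filter, Finset.mem_univ, true_and] at he
      simpa [← he] using e.2
    · intro e he e' he' h
      simp only [Finset.mem_filter, Finset.mem_univ, true_and] at he he'
      exact Subtype.ext (Prod.ext h (he.trans he'.symm))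
    · intro x hx
      exact ⟨⟨(x, v), by simpa using hx⟩, by simp, rfl⟩
  rw [this, Finset.card_erase_of_mem (Finset.mem_univ _), Finset.card_univ, Fintype.card_fin]

lemma card_dEdge (n : ℕ) : Fintype.card (DEdge n) = n * (n - 1) := by
  rw [← Finset.card_univ, Finset.card_eq_sum_card_fiberwise
    (f := fun e : DEdge n => e.val.2) (t := Finset.univ) (by simp)]
  simp [card_filter_snd_eq]

lemma card_earlyEdges {m : ℕ} (hm : m ≤ n * (n - 1)) : (earlyEdges n m).card = m := by
  have h : (earlyEdges n m).card =
      (Finset.univ.filter fun i : Fin (Fintype.card (DEdge n)) => i.val < m).card := by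
    refine Finset.card_bij (fun e _ => Fintype.equivFin (DEdge n) e) ?_ ?_ ?_
    · intro e he
      simpa [earlyEdges] using he
    · intro e _ e' _ h
      exact (Fintype.equivFin _).injective h
    · intro i hi
      exact ⟨(Fintype.equivFin _).symm i, by simpa [earlyEdges] using hi, by simp⟩
  rw [h, Fin.card_filter_val_lt, card_dEdge, min_eq_right hm]

lemma edgePos_injective (ω : SampleSpace n) : Function.Injective (edgePos ω) := by
  intro e e' h
  exact ω.1.injective ((Fintype.equivFin _).injective (Fin.ext h))

lemma InDegreeZero.anti {ω : SampleSpace n} {m m' : ℕ} (h : m ≤ m') {v : Fin n}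
    (hv : InDegreeZero ω m' v) : InDegreeZero ω m v :=
  fun e he => hv e (lt_of_lt_of_le he h)

lemma ZEvent.mono {ω : SampleSpace n} {m m' : ℕ} (h : m ≤ m') (hZ : ZEvent ω m) :
    ZEvent ω m' :=
  Set.Subsingleton.anti hZ fun _ hv => InDegreeZero.anti h hv

lemma exists_edge_to (hn : 2 ≤ n) (v : Fin n) : ∃ e : DEdge n, e.val.2 = v := by
  have : Nontrivial (Fin n) := Fin.nontrivial_iff_two_le.2 hn
  obtain ⟨x, hx⟩ := exists_ne v
  exact ⟨⟨(x, v), hx⟩, rfl⟩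

lemma zEvent_total (hn : 2 ≤ n) (ω : SampleSpace n) : ZEvent ω (n * (n - 1)) := by
  intro v hv
  obtain ⟨e, he⟩ := exists_edge_to hn v
  refine absurd he (hv e ?_)
  unfold inProcess edgePos
  exact (Fin.is_lt _).trans_eq (card_dEdge n)

lemma zEvent_hitTime (hn : 2 ≤ n) (ω : SampleSpace n) : ZEvent ω (hitTime n (ZEvent ω)) := by
  have h : hitTime n (ZEvent ω) ∈ ({m | ZEvent ω m} ∪ {n * (n - 1)} : Set ℕ) :=
    Nat.sInf_mem ⟨n * (n - 1), by simp⟩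
  rcases h with h | h
  · exact h
  · rw [Set.mem_singleton_iff] at h
    rw [h]
    exact zEvent_total hn ω

lemma le_hitTime (hn : 2 ≤ n) (ω : SampleSpace n) {m : ℕ} (hm : ¬ ZEvent ω m) :
    m ≤ hitTime n (ZEvent ω) := by
  by_contra! h
  exact hm (ZEvent.mono h.le (zEvent_hitTime hn ω))

/-- At the hitting time exactly one vertex has in-degree zero. -/
lemma exists_unique_inDegreeZero (hn : 2 ≤ n) (ω : SampleSpace n) {m : ℕ}
    (hm : ¬ ZEvent ω m) :
    ∃ u, InDegreeZero ω m u ∧ ∀ v, v ≠ u → ∃ e, inProcess ω (hitTime n (ZEvent ω)) e ∧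
      e.val.2 = v := by
  set M := hitTime n (ZEvent ω) with hM
  have hZ : ZEvent ω M := zEvent_hitTime hn ω
  have hmM : m ≤ M := le_hitTime hn ω hm
  have hM0 : 0 < M := by
    rcases Nat.eq_zero_or_pos M with h | h
    · have : m = M := by omega
      exact absurd (this ▸ hZ) hm
    · exact h
  have hprev : ¬ ZEvent ω (M - 1) := by
    intro h
    have : M ≤ M - 1 := Nat.sInf_le (Or.inl h)
    omega
  have key : ∃ u, InDegreeZero ω M u := by
    unfold ZEvent at hprev
    rw [Set.not_subsingleton_iff] at hprev
    obtain ⟨a, ha, b, hb, hab⟩ := hprev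
    by_contra! hno
    have hlast : ∀ v, InDegreeZero ω (M - 1) v → ∃ e, edgePos ω e = M - 1 ∧ e.val.2 = v := by
      intro v hv
      have := hno v
      unfold InDegreeZero at this
      push Not at this
      obtain ⟨e, he, hev⟩ := this
      refine ⟨e, ?_, hev⟩
      have h1 : ¬ edgePos ω e < M - 1 := fun h => hv e h hev
      have h2 : edgePos ω e < M := he
      omega
    obtain ⟨e, he, rfl⟩ := hlast a ha
    obtain ⟨e', he', rfl⟩ := hlast b hb
    rw [edgePos_injective ω (he.trans he'.symm)] at hab
    exact hab rfl
  obtain ⟨u, hu⟩ := key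
  refine ⟨u, hu.anti hmM, fun v hv => ?_⟩
  by_contra! h
  exact hv (hZ (fun e he => h e he) hu)

end HittingTime

section Trees

variable {n : ℕ}

/-- The candidate parent maps of a tree with vertex set `U` rooted at `v`. -/
def parentMaps (v : Fin n) (U : Finset (Fin n)) : Finset (Fin n → Fin n) :=
  Fintype.piFinset fun x => if x ∈ U ∧ x ≠ v then U else {v}

/-- The edges from parents to children determined by a parent map. -/
def treeEdges (v : Fin n) (U : Finset (Fin n)) (par : Fin n → Fin n) : Finset (DEdge n) :=
  Finset.univ.filter fun e => e.val.2 ∈ U ∧ e.val.2 ≠ v ∧ e.val.1 = par e.val.2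

/-- A parent map without fixed points. -/
def IsParentMap (v : Fin n) (U : Finset (Fin n)) (par : Fin n → Fin n) : Prop :=
  v ∈ U ∧ par ∈ parentMaps v U ∧ ∀ x ∈ U, x ≠ v → par x ≠ x

lemma card_parentMaps {v : Fin n} {U : Finset (Fin n)} (hv : v ∈ U) :
    (parentMaps v U).card = U.card ^ (U.card - 1) := by
  unfold parentMaps
  rw [Fintype.card_piFinset]
  have h : ∀ x, (if x ∈ U ∧ x ≠ v then U else {v}).card = if x ∈ U.erase v then U.card else 1 := by
    intro x
    by_cases hx : x ∈ U <;> by_cases hxv : x = v <;> simp [hx, hxv]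
  simp_rw [h]
  rw [Finset.prod_ite_mem, Finset.univ_inter, Finset.prod_const, Finset.card_erase_of_mem hv]

lemma card_treeEdges {v : Fin n} {U : Finset (Fin n)} {par : Fin n → Fin n}
    (h : IsParentMap v U par) : (treeEdges v U par).card = U.card - 1 := by
  rw [← Finset.card_erase_of_mem h.1]
  refine Finset.card_bij (fun e _ => e.val.2) ?_ ?_ ?_
  · intro e he
    simp only [treeEdges, Finset.mem_filter, Finset.mem_univ, true_and] at he
    exact Finset.mem_erase.2 ⟨he.2.1, he.1⟩
  · intro e he e' he' heq
    simp only [treeEdges, Finset.mem_filter, Finset.mem_univ, true_and] at he he'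
    refine Subtype.ext (Prod.ext ?_ heq)
    rw [he.2.2, he'.2.2, heq]
  · intro x hx
    rw [Finset.mem_erase] at hx
    exact ⟨⟨(par x, x), h.2.2 x hx.2 hx.1⟩, by simp [treeEdges, hx.1, hx.2], rfl⟩

lemma card_treeEdges_le (v : Fin n) (U : Finset (Fin n)) (par : Fin n → Fin n) :
    (treeEdges v U par).card ≤ U.card := by
  refine Finset.card_le_card_of_injOn (fun e => e.val.2) ?_ ?_
  · intro e he
    simp only [treeEdges, Finset.coe_filter, Finset.mem_univ, true_and, Set.mem_ofPred_eq] at he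
    exact he.1
  · intro e he e' he' heq
    simp only [treeEdges, Finset.coe_filter, Finset.mem_univ, true_and, Set.mem_ofPred_eq]
      at he he' heq
    refine Subtype.ext (Prod.ext ?_ heq)
    rw [he.2.2, he'.2.2, heq]

/-- Rainbow arborescences grow as long as every partial one can be extended. -/
lemma exists_rainbow_tree {W : Type*} [DecidableEq W] (D : Finset (DEdge n)) (g : DEdge n → W)
    (C : Finset W) (u : Fin n) (t₀ : ℕ)
    (hext : ∀ U par, IsParentMap u U par → U.card < t₀ → treeEdges u U par ⊆ D →
      ∃ e ∈ D, e.val.1 ∈ U ∧ e.val.2 ∉ U ∧ g e ∈ C ∧ g e ∉ (treeEdges u U par).image g)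
    (t : ℕ) (ht : 1 ≤ t) (ht₀ : t ≤ t₀) :
    ∃ U par, IsParentMap u U par ∧ U.card = t ∧ treeEdges u U par ⊆ D ∧
      Set.InjOn g (treeEdges u U par) ∧ (∀ e ∈ treeEdges u U par, g e ∈ C) ∧
      ∀ x ∈ U, Relation.ReflTransGen
        (fun x y => ∃ e ∈ treeEdges u U par, (e : DEdge n).val = (x, y)) u x := by
  induction t, ht using Nat.le_induction with
  | base =>
    have hempty : treeEdges u {u} (fun _ => u) = ∅ := by
      ext e
      simp only [treeEdges, Finset.mem_filter, Finset.mem_univ, true_and, Finset.mem_singleton,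
        Finset.notMem_empty, iff_false]
      tauto
    refine ⟨{u}, fun _ => u, ⟨by simp, ?_, ?_⟩, by simp, by simp [hempty], by simp [hempty],
      by simp [hempty], ?_⟩
    · unfold parentMaps
      rw [Fintype.mem_piFinset]
      intro x
      split_ifs <;> simp
    · intro x hx hxu
      exact absurd (Finset.mem_singleton.1 hx) hxu
    · intro x hx
      rw [Finset.mem_singleton.1 hx]
  | succ t ht ih =>
    obtain ⟨U, par, hpar, hcard, hD, hinj, hC, hreach⟩ := ih (by omega)
    obtain ⟨e, heD, he1, he2, heC, heT⟩ := hext U par hpar (by omega) hD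
    have hne : e.val.2 ≠ u := fun h => he2 (h ▸ hpar.1)
    have hins : treeEdges u (insert e.val.2 U) (Function.update par e.val.2 e.val.1) =
        insert e (treeEdges u U par) := by
      ext e'
      simp only [treeEdges, Finset.mem_filter, Finset.mem_univ, true_and, Finset.mem_insert]
      by_cases h : e'.val.2 = e.val.2
      · rw [h, Function.update_self]
        constructor
        · rintro ⟨-, -, h1⟩
          exact Or.inl (Subtype.ext (Prod.ext h1 h))
        · rintro (rfl | h1)
          · exact ⟨Or.inl rfl, hne, rfl⟩
          · exact absurd h1.1 he2
      · rw [Function.update_of_ne h]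
        constructor
        · rintro ⟨h1 | h1, h2⟩
          · exact absurd h1 h
          · exact Or.inr ⟨h1, h2⟩
        · rintro (rfl | ⟨h1, h2⟩)
          · exact absurd rfl h
          · exact ⟨Or.inr h1, h2⟩
    refine ⟨insert e.val.2 U, Function.update par e.val.2 e.val.1, ⟨?_, ?_, ?_⟩, ?_, ?_, ?_, ?_, ?_⟩
    · exact Finset.mem_insert_of_mem hpar.1
    · unfold parentMaps
      rw [Fintype.mem_piFinset]
      intro x
      by_cases hx : x = e.val.2
      · subst hx
        simp [hne, he1]
      · rw [Function.update_of_ne hx]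
        have := Fintype.mem_piFinset.1 hpar.2.1 x
        by_cases hxU : x ∈ U ∧ x ≠ u
        · rw [if_pos hxU] at this
          rw [if_pos ⟨Finset.mem_insert_of_mem hxU.1, hxU.2⟩]
          exact Finset.mem_insert_of_mem this
        · rw [if_neg hxU] at this
          rw [if_neg]
          · exact this
          · rintro ⟨h1, h2⟩
            exact hxU ⟨(Finset.mem_insert.1 h1).resolve_left hx, h2⟩
    · intro x hx hxu
      by_cases h : x = e.val.2
      · subst h
        rw [Function.update_self]
        exact e.2
      · rw [Function.update_of_ne h]
        exact hpar.2.2 x ((Finset.mem_insert.1 hx).resolve_left h) hxu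
    · rw [Finset.card_insert_of_notMem he2, hcard]
    · rw [hins]
      exact Finset.insert_subset heD hD
    · rw [hins, Finset.coe_insert, Set.injOn_insert]
      · refine ⟨hinj, ?_⟩
        intro h
        apply heT
        simpa using h
      · intro h
        exact heT (Finset.mem_image_of_mem g h)
    · rw [hins]
      intro e' he'
      rcases Finset.mem_insert.1 he' with rfl | h
      · exact heC
      · exact hC e' h
    · rw [hins]
      have hmono : ∀ x ∈ U, Relation.ReflTransGen
          (fun x y => ∃ e' ∈ insert e (treeEdges u U par), (e' : DEdge n).val = (x, y)) u x := by
        intro x hx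
        refine Relation.ReflTransGen.mono ?_ u x (hreach x hx)
        rintro a b ⟨e', he', h⟩
        exact ⟨e', Finset.mem_insert_of_mem he', h⟩
      intro x hx
      rcases Finset.mem_insert.1 hx with rfl | h
      · exact (hmono _ he1).tail ⟨e, Finset.mem_insert_self _ _, rfl⟩
      · exact hmono x h

end Trees

section Deterministic

variable {n : ℕ}

/-- The edges of `D(n,m)` for a given ordering. -/
noncomputable def graphEdges (σ : Equiv.Perm (DEdge n)) (m : ℕ) : Finset (DEdge n) :=
  Finset.univ.filter fun e => σ e ∈ earlyEdges n m

lemma mem_graphEdges {σ : Equiv.Perm (DEdge n)} {m : ℕ} {e : DEdge n} :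
    e ∈ graphEdges σ m ↔ σ e ∈ earlyEdges n m := by
  simp [graphEdges]

/-- The edges of `D(n,m)` with head `v`. -/
noncomputable def inEdges (σ : Equiv.Perm (DEdge n)) (m : ℕ) (v : Fin n) : Finset (DEdge n) :=
  (graphEdges σ m).filter fun e => e.val.2 = v

/-- The vertices of in-degree less than `K` in `D(n,m)`. -/
noncomputable def smallVertices (σ : Equiv.Perm (DEdge n)) (m K : ℕ) : Finset (Fin n) :=
  Finset.univ.filter fun v => (inEdges σ m v).card < K

lemma mem_smallVertices {σ : Equiv.Perm (DEdge n)} {m K : ℕ} {v : Fin n} :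
    v ∈ smallVertices σ m K ↔ (inEdges σ m v).card < K := by
  simp [smallVertices]

/-- The event that every vertex of in-degree zero lies only in partial trees (of size less
than `t₀`) that can be extended by an edge with a new colour from `W₂` which is not used by an
edge of `F`. -/
def TreesExtend (m t₀ : ℕ) (W₂ : Finset (Colour n)) (F : Finset (DEdge n))
    (ω : SampleSpace n) : Prop :=
  ∀ v, InDegreeZero ω m v → ∀ U par, IsParentMap v U par → U.card < t₀ →
    treeEdges v U par ⊆ graphEdges ω.1 m →
    ∃ e ∈ graphEdges ω.1 m, (e.val.1 ∈ U ∧ e.val.2 ∉ U ∧ e ∉ F) ∧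
      ω.2 e ∉ W₂ᶜ ∪ (treeEdges v U par ∪ F).image ω.2

/-- Hall's condition for the vertices outside `S`, with the colours in `W₂` and those used by
an edge of `F` removed. -/
def HallOutside (m : ℕ) (W₂ : Finset (Colour n)) (S : Finset (Fin n)) (F : Finset (DEdge n))
    (ω : SampleSpace n) : Prop :=
  ∀ A : Finset (Fin n), A.Nonempty → Disjoint A S → ∀ R : Finset (Colour n), R.card = A.card →
    ∃ e ∈ graphEdges ω.1 m, e.val.2 ∈ A ∧ ω.2 e ∉ W₂ ∪ R ∪ F.image ω.2

lemma exists_assignment_and_arborescence (hn : 2 ≤ n) (ω : SampleSpace n) (m K t₀ : ℕ)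
    (hw : n ≤ numColours n) (hK : 1 ≤ K) (ht₀ : 1 ≤ t₀)
    (W₂ : Finset (Colour n)) (fe : Fin n → DEdge n)
    (hfe : ∀ v, (fe v).val.2 = v) (hfe' : ∀ e : DEdge n, edgePos ω (fe e.val.2) ≤ edgePos ω e)
    (hZ : ¬ ZEvent ω m)
    (hinj : Set.InjOn (fun v => ω.2 (fe v)) (smallVertices ω.1 m K))
    (htree : TreesExtend m t₀ W₂ ((smallVertices ω.1 m K).image fe) ω)
    (hhall : HallOutside m W₂ (smallVertices ω.1 m K) ((smallVertices ω.1 m K).image fe) ω) :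
    ∃ (T : Set (Colour n)) (u : Fin n) (f : Fin n → Colour n),
      T.ncard = n - 1 ∧
      Set.BijOn f {v : Fin n | v ≠ u} T ∧
      (∀ v : Fin n, v ≠ u → ∃ e : DEdge n,
        inProcess ω (hitTime n (ZEvent ω)) e ∧ e.val.2 = v ∧ ω.2 e = f v) ∧
      ∃ A : Set (DEdge n),
        (∀ e ∈ A, inProcess ω (hitTime n (ZEvent ω)) e) ∧
        IsArborescenceRootedAt A u ∧
        Set.InjOn ω.2 A ∧
        (∀ e ∈ A, ω.2 e ∉ T) ∧
        t₀ ≤ ({u} ∪ {v : Fin n | ∃ e ∈ A, (e : DEdge n).val.2 = v}).ncard := by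
  set S := smallVertices ω.1 m K with hS
  set F := S.image fe with hF
  obtain ⟨u, hu, hothers⟩ := exists_unique_inDegreeZero hn ω hZ
  have hD : ∀ e ∈ graphEdges ω.1 m, inProcess ω (hitTime n (ZEvent ω)) e := by
    intro e he
    have h1 : inProcess ω m e := (inProcess_iff ω m e).2 (mem_graphEdges.1 he)
    exact lt_of_lt_of_le h1 (le_hitTime hn ω hZ)
  have huS : u ∈ S := by
    rw [hS, mem_smallVertices]
    have : inEdges ω.1 m u = ∅ := by
      ext e
      simp only [inEdges, Finset.mem_filter, mem_graphEdges, ← inProcess_iff, Finset.notMem_empty,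
        iff_false, not_and]
      exact fun h => hu e h
    rw [this]
    exact hK
  -- the assignment outside `S`
  have hhall' : ∃ h : {v // v ∉ S} → Colour n, Function.Injective h ∧
      ∀ v, h v ∈ ((inEdges ω.1 m v.1).image ω.2) \ (W₂ ∪ F.image ω.2) := by
    rw [← Finset.all_card_le_biUnion_card_iff_exists_injective]
    intro A
    by_contra! hlt
    have hcard : A.card ≤ Fintype.card (Colour n) := by
      rw [Fintype.card_fin]
      calc A.card ≤ Fintype.card {v // v ∉ S} := Finset.card_le_univ A
        _ ≤ Fintype.card (Fin n) := Fintype.card_subtype_le _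
        _ ≤ _ := by simpa using hw
    obtain ⟨R, hR, hRcard⟩ := Finset.exists_superset_card_eq hlt.le hcard
    have hAne : A.Nonempty := by
      rw [← Finset.card_pos]; omega
    obtain ⟨e, he, heA, hec⟩ := hhall (A.map (Function.Embedding.subtype _)) (by simpa using hAne)
      (by
        rw [Finset.disjoint_left]
        intro x hx
        simp only [Finset.mem_map, Function.Embedding.coe_subtype, Subtype.exists,
          exists_and_right, exists_eq_right] at hx
        exact hx.1) R (by simpa using hRcard)
    simp only [Finset.mem_map, Function.Embedding.coe_subtype, Subtype.exists,
      exists_and_right, exists_eq_right] at heA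
    obtain ⟨hxS, hxA⟩ := heA
    apply hec
    simp only [Finset.mem_union, not_or] at hec
    refine Finset.mem_union_left _ (Finset.mem_union_right _ (hR ?_))
    refine Finset.mem_biUnion.2 ⟨⟨e.val.2, hxS⟩, hxA, ?_⟩
    rw [Finset.mem_sdiff]
    refine ⟨Finset.mem_image_of_mem _ ?_, ?_⟩
    · simp [inEdges, he]
    · rw [Finset.mem_union]
      tauto
  obtain ⟨h, hhinj, hh⟩ := hhall'
  classical
  let f : Fin n → Colour n := fun v => if hv : v ∉ S then h ⟨v, hv⟩ else ω.2 (fe v)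
  have hfS : ∀ v ∈ S, f v = ω.2 (fe v) := fun v hv => dif_neg (not_not.2 hv)
  have hfL : ∀ v (hv : v ∉ S), f v = h ⟨v, hv⟩ := fun v hv => dif_pos hv
  have hfSF : ∀ v ∈ S, f v ∈ F.image ω.2 := fun v hv => by
    rw [hfS v hv]
    exact Finset.mem_image_of_mem _ (Finset.mem_image_of_mem _ hv)
  have hfLF : ∀ v ∉ S, f v ∉ W₂ ∪ F.image ω.2 := fun v hv => by
    rw [hfL v hv]
    exact (Finset.mem_sdiff.1 (hh ⟨v, hv⟩)).2
  have hf : Function.Injective f := by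
    intro v v' hvv
    by_cases hv : v ∈ S <;> by_cases hv' : v' ∈ S
    · rw [hfS v hv, hfS v' hv'] at hvv
      exact hinj hv hv' hvv
    · exact absurd (Finset.mem_union_right _ (hvv ▸ hfSF v hv)) (hfLF v' hv')
    · exact absurd (Finset.mem_union_right _ (hvv.symm ▸ hfSF v' hv')) (hfLF v hv)
    · rw [hfL v hv, hfL v' hv'] at hvv
      exact congrArg Subtype.val (hhinj hvv)
  -- the tree
  obtain ⟨U, par, hpar, hcard, hTD, hTinj, hTC, hreach⟩ :=
    exists_rainbow_tree (graphEdges ω.1 m) ω.2 (W₂ \ F.image ω.2) u t₀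
      (fun U par hpar hlt hTD => by
        obtain ⟨e, he, ⟨he1, he2, -⟩, hec⟩ := htree u hu U par hpar hlt hTD
        simp only [Finset.image_union, Finset.mem_union, Finset.mem_compl, not_or, not_not] at hec
        exact ⟨e, he, he1, he2, Finset.mem_sdiff.2 ⟨hec.1, hec.2.2⟩, hec.2.1⟩) t₀ ht₀ le_rfl
  refine ⟨f '' {v | v ≠ u}, u, f, ?_, hf.injOn.bijOn_image, ?_, (treeEdges u U par : Set (DEdge n)),
    ?_, ⟨?_, ?_, ?_⟩, hTinj, ?_, ?_⟩
  · rw [Set.ncard_image_of_injective _ hf]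
    have : {v : Fin n | v ≠ u} = ((Finset.univ.erase u : Finset (Fin n)) : Set (Fin n)) := by
      ext x; simp
    rw [this, Set.ncard_coe_finset, Finset.card_erase_of_mem (Finset.mem_univ _),
      Finset.card_univ, Fintype.card_fin]
  · intro v hv
    by_cases hvS : v ∈ S
    · obtain ⟨e, he, rfl⟩ := hothers v hv
      exact ⟨fe e.val.2, lt_of_le_of_lt (hfe' e) he, hfe _, (hfS _ hvS).symm⟩
    · have h1 := (Finset.mem_sdiff.1 (hh ⟨v, hvS⟩)).1
      rw [Finset.mem_image] at h1
      obtain ⟨e, he, hec⟩ := h1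
      rw [inEdges, Finset.mem_filter] at he
      exact ⟨e, hD e he.1, he.2, hec.trans (hfL v hvS).symm⟩
  · exact fun e he => hD e (hTD he)
  · intro e he
    have he : e ∈ treeEdges u U par := he
    simp only [treeEdges, Finset.mem_filter, Finset.mem_univ, true_and] at he
    exact he.2.1
  · rintro v ⟨e, he, rfl⟩
    refine ⟨e, ⟨he, rfl⟩, ?_⟩
    rintro e' ⟨he', heq⟩
    rw [Finset.mem_coe] at he he'
    simp only [treeEdges, Finset.mem_filter, Finset.mem_univ, true_and] at he he'
    refine Subtype.ext (Prod.ext ?_ heq)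
    rw [he'.2.2, heq, he.2.2]
  · intro e he
    have he' : e ∈ treeEdges u U par := he
    simp only [treeEdges, Finset.mem_filter, Finset.mem_univ, true_and] at he'
    exact hreach _ he'.1
  · rintro e he ⟨v, -, hv⟩
    have h1 := Finset.mem_sdiff.1 (hTC e he)
    rw [← hv] at h1
    by_cases hvS : v ∈ S
    · exact h1.2 (hfSF v hvS)
    · exact hfLF v hvS (Finset.mem_union_left _ h1.1)
  · rw [← hcard, ← Set.ncard_coe_finset]
    refine Set.ncard_le_ncard ?_ (Set.toFinite _)
    intro x hx
    by_cases hxu : x = u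
    · left; exact hxu
    · right
      refine ⟨⟨(par x, x), hpar.2.2 x hx hxu⟩, ?_, rfl⟩
      rw [Finset.mem_coe]
      rw [Finset.mem_coe] at hx
      simp [treeEdges, hx, hxu]

end Deterministic

section SecondMoment

variable {n : ℕ}

lemma indicator_congr {p q : Prop} {_ : Decidable p} {_ : Decidable q} (h : p ↔ q) :
    (if p then (1 : ℝ) else 0) = if q then 1 else 0 := by
  by_cases hp : p
  · rw [if_pos hp, if_pos (h.1 hp)]
  · rw [if_neg hp, if_neg (mt h.2 hp)]

lemma sepProb_empty_left {α : Type*} [Fintype α] [DecidableEq α] (M B : Finset α) :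
    sepProb M ∅ B = ∏ i ∈ Finset.range B.card,
      (((Fintype.card α : ℝ) - M.card - i) / ((Fintype.card α : ℝ) - i)) := by
  induction B using Finset.induction_on with
  | empty => simpa using sepProb_empty M
  | insert e B he ih =>
    have h := sepProb_insert_right M ∅ B (by simp) (by simp) he
    have hlt : (B.card : ℝ) < Fintype.card α := by
      have := Finset.card_le_univ (insert e B)
      rw [Finset.card_insert_of_notMem he] at this
      exact_mod_cast this
    rw [Finset.card_insert_of_notMem he, Finset.prod_range_succ, ← ih, ← mul_div_assoc,
      eq_div_iff (by linarith)]
    simpa using h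

/-- The edges with head `v`. -/
def edgesInto (v : Fin n) : Finset (DEdge n) := Finset.univ.filter fun e => e.val.2 = v

lemma mem_edgesInto {v : Fin n} {e : DEdge n} : e ∈ edgesInto v ↔ e.val.2 = v := by
  simp [edgesInto]

lemma card_edgesInto (v : Fin n) : (edgesInto v).card = n - 1 := card_filter_snd_eq v

lemma disjoint_edgesInto {v w : Fin n} (h : v ≠ w) : Disjoint (edgesInto v) (edgesInto w) :=
  Finset.disjoint_left.2 fun _ he he' => h ((mem_edgesInto.1 he).symm.trans (mem_edgesInto.1 he'))

lemma inDegreeZero_iff {ω : SampleSpace n} {m : ℕ} {v : Fin n} :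
    InDegreeZero ω m v ↔ ∀ e ∈ edgesInto v, ω.1 e ∉ earlyEdges n m := by
  simp only [InDegreeZero, mem_edgesInto, inProcess_iff]
  exact ⟨fun h e he hm => h e hm he, fun h e he hm => h e hm he⟩

lemma nat_cast_mul_pred (n : ℕ) : ((n * (n - 1) : ℕ) : ℝ) = n * (n - 1) := by
  cases n <;> simp

/-- The expected number of vertices of in-degree zero. -/
noncomputable def meanZero (n m : ℕ) : ℝ :=
  n * ∏ i ∈ Finset.range (n - 1), (((n * (n - 1) : ℕ) : ℝ) - m - i) / (((n * (n - 1) : ℕ) : ℝ) - i)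

lemma prob_zEvent_le {m : ℕ} (hm : m + 2 * (n - 1) ≤ n * (n - 1)) (hμ : 1 < meanZero n m) :
    prob (fun ω : SampleSpace n => ZEvent ω m) ≤ meanZero n m / (meanZero n m - 1) ^ 2 := by
  classical
  set μ := meanZero n m with hμdef
  set N := n * (n - 1) with hN
  have hn : 2 ≤ n := by
    by_contra! h
    interval_cases n <;> norm_num [meanZero, hμdef] at hμ
  have hcardE : Fintype.card (DEdge n) = N := card_dEdge n
  have hcardM : (earlyEdges n m).card = m := card_earlyEdges (by omega)
  let H : ℕ → ℝ := fun k => ∏ i ∈ Finset.range k, (((N : ℝ) - m - i) / ((N : ℝ) - i))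
  have hH : ∀ B : Finset (DEdge n), sepProb (earlyEdges n m) ∅ B = H B.card := by
    intro B
    rw [sepProb_empty_left, hcardE, hcardM]
  have hmR : (m : ℝ) + 2 * ((n - 1 : ℕ) : ℝ) ≤ N := by exact_mod_cast hm
  have hpos : 0 < ((n - 1 : ℕ) : ℝ) := by exact_mod_cast (by omega : 0 < n - 1)
  have hm0 : (0 : ℝ) ≤ m := Nat.cast_nonneg _
  have hfac : ∀ i < 2 * (n - 1), 0 ≤ (((N : ℝ) - m - i) / ((N : ℝ) - i)) := by
    intro i hi
    have : (i : ℝ) ≤ 2 * ((n - 1 : ℕ) : ℝ) := by exact_mod_cast hi.le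
    exact div_nonneg (by linarith) (by linarith)
  have hH0 : 0 ≤ H (n - 1) := Finset.prod_nonneg fun i hi =>
    hfac i (by have := Finset.mem_range.1 hi; omega)
  have hH2 : H (2 * (n - 1)) ≤ H (n - 1) ^ 2 := by
    have : H (2 * (n - 1)) = H (n - 1) * ∏ i ∈ Finset.range (n - 1),
        (((N : ℝ) - m - (n - 1 + i : ℕ)) / ((N : ℝ) - (n - 1 + i : ℕ))) := by
      simp only [H]
      rw [two_mul, Finset.prod_range_add]
    rw [this, sq]
    refine mul_le_mul_of_nonneg_left ?_ hH0
    refine Finset.prod_le_prod (fun i hi => ?_) fun i hi => ?_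
    · have := Finset.mem_range.1 hi
      exact hfac _ (by omega)
    · have h1 : (i : ℝ) + 1 ≤ ((n - 1 : ℕ) : ℝ) := by exact_mod_cast Finset.mem_range.1 hi
      push_cast
      rw [div_le_div_iff₀ (by linarith) (by linarith)]
      have : 0 ≤ (m : ℝ) * ((n - 1 : ℕ) : ℝ) := by positivity
      nlinarith
  let Y : Fin n → Equiv.Perm (DEdge n) → ℝ := fun v σ =>
    if ∀ e ∈ edgesInto v, σ e ∉ earlyEdges n m then 1 else 0
  have hY : ∀ v, avg (Y v) = H (n - 1) := by
    intro v
    rw [← card_edgesInto v, ← hH, sepProb, prob_eq_avg]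
    refine congrArg avg (funext fun σ => ?_)
    simp [Y]
  have hYY : ∀ v w, v ≠ w → avg (fun σ => Y v σ * Y w σ) = H (2 * (n - 1)) := by
    intro v w hvw
    have : 2 * (n - 1) = (edgesInto v ∪ edgesInto w).card := by
      rw [Finset.card_union_of_disjoint (disjoint_edgesInto hvw), card_edgesInto, card_edgesInto,
        two_mul]
    rw [this, ← hH, sepProb, prob_eq_avg]
    refine congrArg avg (funext fun σ => ?_)
    simp only [Y, ite_zero_mul_ite_zero, mul_one]
    refine indicator_congr ?_
    simp only [Finset.notMem_empty, Finset.mem_union, or_imp, forall_and]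
    simp
  have hY0 : ∀ v σ, Y v σ = 0 ∨ Y v σ = 1 := by
    intro v σ
    simp only [Y]
    split_ifs <;> simp
  let X : Equiv.Perm (DEdge n) → ℝ := fun σ => ∑ v, Y v σ
  have hEX : avg X = μ := by
    simp only [X]
    rw [avg_sum]
    simp only [hY, Finset.sum_const, Finset.card_univ, Fintype.card_fin, nsmul_eq_mul]
    rfl
  have hEXX : avg (fun σ => X σ ^ 2) ≤ μ + μ ^ 2 := by
    have h1 : ∀ σ, X σ ^ 2 = ∑ v, ∑ w, Y v σ * Y w σ := fun σ => by
      rw [sq, Finset.sum_mul_sum]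
    simp_rw [h1]
    rw [avg_sum]
    have h2 : ∀ v : Fin n, avg (fun σ => ∑ w, Y v σ * Y w σ) ≤ H (n - 1) + n * H (n - 1) ^ 2 := by
      intro v
      rw [avg_sum]
      calc ∑ w, avg (fun σ => Y v σ * Y w σ) ≤
          ∑ w : Fin n, ((if w = v then H (n - 1) else 0) + H (n - 1) ^ 2) := by
            refine Finset.sum_le_sum fun w _ => ?_
            by_cases hw : w = v
            · subst hw
              have : ∀ σ, Y w σ * Y w σ = Y w σ := fun σ => by
                rcases hY0 w σ with h | h <;> simp [h]
              simp only [this, hY, if_true]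
              nlinarith [sq_nonneg (H (n - 1))]
            · rw [hYY v w (Ne.symm hw), if_neg hw, zero_add]
              exact hH2
        _ = _ := by
            simp [Finset.sum_add_distrib]
    calc _ ≤ ∑ v : Fin n, (H (n - 1) + n * H (n - 1) ^ 2) := Finset.sum_le_sum fun v _ => h2 v
      _ = μ + μ ^ 2 := by
        have : μ = n * H (n - 1) := rfl
        rw [this]
        simp
        ring
  have hμ1 : 0 < (μ - 1) ^ 2 := by
    have : 0 < μ - 1 := by linarith
    positivity
  refine prob_prod_le _ (fun σ => (X σ - μ) ^ 2 / (μ - 1) ^ 2) (fun σ => ?_) |>.trans ?_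
  · by_cases hX : X σ ≤ 1
    · refine (prob_le_one _).trans ?_
      rw [one_le_div hμ1]
      nlinarith
    · have hfalse : ∀ g : DEdge n → Colour n, ¬ ZEvent (σ, g) m := by
        intro g hZ
        apply hX
        have h1 : ∀ v, Y v σ = if InDegreeZero (σ, g) m v then 1 else 0 := by
          intro v
          exact indicator_congr (inDegreeZero_iff (ω := (σ, g))).symm
        simp only [X, h1]
        rw [Finset.sum_boole]
        have : (Finset.univ.filter fun v => InDegreeZero (σ, g) m v).card ≤ 1 := by
          rw [Finset.card_le_one]
          intro a ha b hb
          simp only [Finset.mem_filter, Finset.mem_univ, true_and] at ha hb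
          exact hZ ha hb
        exact_mod_cast this
      have : prob (fun g : DEdge n → Colour n => ZEvent (σ, g) m) = 0 := by
        simp [prob, hfalse]
      rw [this]
      positivity
  · have h1 : ∀ σ, (X σ - μ) ^ 2 / (μ - 1) ^ 2 =
        ((μ - 1) ^ 2)⁻¹ * (X σ ^ 2 + (-(2 * μ)) * X σ + μ ^ 2) := fun σ => by ring
    have h2 : avg (fun σ => X σ ^ 2 + (-(2 * μ)) * X σ + μ ^ 2) ≤ μ := by
      have h3 : avg (fun σ => X σ ^ 2 + (-(2 * μ)) * X σ + μ ^ 2) =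
          avg (fun σ => X σ ^ 2) + (-(2 * μ)) * avg X +
            avg (fun _ : Equiv.Perm (DEdge n) => μ ^ 2) := by
        rw [← avg_const_mul]
        simp only [avg, Finset.sum_add_distrib, add_div]
      rw [h3, hEX, avg_const]
      nlinarith
    simp_rw [h1]
    rw [avg_const_mul, div_eq_inv_mul]
    exact mul_le_mul_of_nonneg_left h2 (by positivity)

lemma le_meanZero {m : ℕ} (hn : 2 ≤ n) (hm : (m : ℝ) ≤ ((n : ℝ) - 1) ^ 2) :
    n * (1 - m / ((n : ℝ) - 1) ^ 2) ^ (n - 1) ≤ meanZero n m := by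
  unfold meanZero
  have hn' : (2 : ℝ) ≤ n := by exact_mod_cast hn
  have hpos : 0 < ((n : ℝ) - 1) ^ 2 := by
    have : 0 < (n : ℝ) - 1 := by linarith
    positivity
  refine mul_le_mul_of_nonneg_left ?_ (Nat.cast_nonneg _)
  rw [← Finset.card_range (n - 1), ← Finset.prod_const, Finset.card_range, nat_cast_mul_pred]
  refine Finset.prod_le_prod (fun i _ => ?_) fun i hi => ?_
  · rw [sub_nonneg]
    exact div_le_one_of_le₀ hm hpos.le
  · have h1 : (i : ℝ) + 1 ≤ ((n - 1 : ℕ) : ℝ) := by exact_mod_cast Finset.mem_range.1 hi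
    rw [Nat.cast_sub (by omega), Nat.cast_one] at h1
    have h2 : ((n : ℝ) - 1) ^ 2 ≤ n * (n - 1) - i := by nlinarith
    have h3 : ((n : ℝ) * (n - 1) - m - i) / (n * (n - 1) - i) = 1 - m / (n * (n - 1) - i) := by
      have : (n : ℝ) * (n - 1) - i ≠ 0 := by linarith
      field_simp
      ring
    rw [h3]
    gcongr

end SecondMoment

section SmallVertices

variable {n : ℕ}

lemma prod_weight_eq (D A B : Finset (DEdge n)) (c : ℝ) :
    ∏ e ∈ Aᶜ, (if e ∈ D then (if e ∈ B then c else 1) else 1) = c ^ ((D ∩ B) \ A).card := by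
  have h : ∀ e, (if e ∈ D then (if e ∈ B then c else 1) else 1) = if e ∈ D ∩ B then c else 1 := by
    intro e
    by_cases h1 : e ∈ D <;> by_cases h2 : e ∈ B <;> simp [h1, h2]
  simp_rw [h]
  rw [Finset.prod_ite]
  simp only [Finset.prod_const, one_pow, mul_one]
  congr 2
  ext e
  simp [and_comm]

lemma avg_pow_card_le {m : ℕ} (hm : m ≤ n * (n - 1)) (A B : Finset (DEdge n)) (hA : A.card ≤ m)
    {c : ℝ} (hc0 : 0 ≤ c) (hc1 : c ≤ 1) :
    avg (fun σ => (if A ⊆ graphEdges σ m then (1 : ℝ) else 0) *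
        c ^ ((graphEdges σ m ∩ B) \ A).card) ≤
      ((m : ℝ) / (n * (n - 1) : ℕ)) ^ A.card *
        Real.exp (-(((m : ℝ) - A.card) / (n * (n - 1) : ℕ) * ((1 - c) * (B \ A).card))) := by
  have h := avg_prod_weight_le (earlyEdges n m) A (by rwa [card_earlyEdges hm])
    (fun e => if e ∈ B then c else 1) (fun e => by split_ifs <;> linarith)
    (fun e => by split_ifs <;> linarith)
  rw [card_earlyEdges hm, card_dEdge] at h
  have hs : ∑ e ∈ Aᶜ, (1 - if e ∈ B then c else 1) = (1 - c) * (B \ A).card := by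
    have : ∀ e, (1 - if e ∈ B then c else 1) = if e ∈ B then 1 - c else 0 := by
      intro e; split_ifs <;> simp
    simp_rw [this]
    rw [← Finset.sum_filter, Finset.sum_const, nsmul_eq_mul, mul_comm]
    congr 3
    ext e
    simp [and_comm]
  rw [hs] at h
  refine le_trans (le_of_eq (congrArg avg (funext fun σ => ?_))) h
  rw [← prod_weight_eq]
  simp only [mem_graphEdges, Finset.subset_iff]

lemma inEdges_eq (σ : Equiv.Perm (DEdge n)) (m : ℕ) (v : Fin n) :
    inEdges σ m v = graphEdges σ m ∩ edgesInto v := by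
  ext e
  simp [inEdges, mem_edgesInto]

lemma avg_card_smallVertices_le {m : ℕ} (hm : m ≤ n * (n - 1)) (K : ℕ) :
    avg (fun σ : Equiv.Perm (DEdge n) => ((smallVertices σ m K).card : ℝ)) ≤
      n * (4 ^ K * Real.exp (-((m : ℝ) / (n * (n - 1) : ℕ) * (3 / 4 * (n - 1 : ℕ))))) := by
  have h : ∀ σ : Equiv.Perm (DEdge n), ((smallVertices σ m K).card : ℝ) ≤
      ∑ v : Fin n, 4 ^ K * ((if ∅ ⊆ graphEdges σ m then (1 : ℝ) else 0) *
        (1 / 4) ^ ((graphEdges σ m ∩ edgesInto v) \ ∅).card) := by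
    intro σ
    rw [smallVertices, Finset.card_filter, Nat.cast_sum]
    refine Finset.sum_le_sum fun v _ => ?_
    rw [Finset.sdiff_empty, ← inEdges_eq, if_pos (Finset.empty_subset _), one_mul]
    by_cases hv : (inEdges σ m v).card < K
    · rw [if_pos hv, one_div, inv_pow, ← div_eq_mul_inv, Nat.cast_one, one_le_div (by positivity)]
      exact pow_le_pow_right₀ (by norm_num) hv.le
    · rw [if_neg hv, Nat.cast_zero]
      positivity
  refine (avg_mono h).trans ?_
  rw [avg_sum]
  have h2 : ∀ v ∈ (Finset.univ : Finset (Fin n)), avg (fun σ => 4 ^ K *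
      ((if ∅ ⊆ graphEdges σ m then (1 : ℝ) else 0) *
        (1 / 4) ^ ((graphEdges σ m ∩ edgesInto v) \ ∅).card)) ≤
      4 ^ K * Real.exp (-((m : ℝ) / (n * (n - 1) : ℕ) * (3 / 4 * (n - 1 : ℕ)))) := by
    intro v _
    rw [avg_const_mul]
    refine mul_le_mul_of_nonneg_left ?_ (by positivity)
    refine (avg_pow_card_le hm ∅ (edgesInto v) (by simp) (by norm_num) (by norm_num)).trans ?_
    rw [Finset.sdiff_empty, card_edgesInto]
    norm_num
  refine (Finset.sum_le_sum h2).trans ?_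
  simp

/-- Two distinct edges of the digraph with the same tail have heads in `S`. -/
def HasCherry (D : Finset (DEdge n)) (S : Finset (Fin n)) : Prop :=
  ∃ e ∈ D, ∃ e' ∈ D, e ≠ e' ∧ e.val.1 = e'.val.1 ∧ e.val.2 ∈ S ∧ e'.val.2 ∈ S

lemma prob_hasCherry_le {m : ℕ} (hm : m ≤ n * (n - 1)) (hm2 : 2 ≤ m) (K : ℕ) :
    prob (fun σ : Equiv.Perm (DEdge n) => HasCherry (graphEdges σ m) (smallVertices σ m K)) ≤
      (n : ℝ) ^ 3 * (16 ^ K * (((m : ℝ) / (n * (n - 1) : ℕ)) ^ 2 *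
        Real.exp (-(((m : ℝ) - 2) / (n * (n - 1) : ℕ) * (3 / 4 * (2 * (n - 1 : ℕ) - 2)))))) := by
  classical
  let P : Finset (DEdge n × DEdge n) :=
    Finset.univ.filter fun p => p.1 ≠ p.2 ∧ p.1.val.1 = p.2.val.1
  have hP : P.card ≤ n ^ 3 := by
    calc P.card ≤ (Finset.univ : Finset (Fin n × Fin n × Fin n)).card := by
          refine Finset.card_le_card_of_injOn (fun p => (p.1.val.1, p.1.val.2, p.2.val.2))
            (fun _ _ => Finset.mem_coe.2 (Finset.mem_univ _)) ?_
          rintro ⟨a, b⟩ hab ⟨a', b'⟩ hab' h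
          simp only [P, Finset.coe_filter, Finset.mem_univ, true_and, Set.mem_ofPred_eq] at hab hab'
          simp only [Prod.mk.injEq] at h
          refine Prod.ext (Subtype.ext (Prod.ext h.1 h.2.1)) (Subtype.ext (Prod.ext ?_ h.2.2))
          dsimp only
          rw [← hab.2, ← hab'.2, h.1]
      _ = n ^ 3 := by simp; ring
  let Q : DEdge n × DEdge n → Equiv.Perm (DEdge n) → Prop := fun p σ =>
    {p.1, p.2} ⊆ graphEdges σ m ∧ (inEdges σ m p.1.val.2).card < K ∧
      (inEdges σ m p.2.val.2).card < K
  have hQ : ∀ p ∈ P, prob (Q p) ≤ 16 ^ K * (((m : ℝ) / (n * (n - 1) : ℕ)) ^ 2 *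
      Real.exp (-(((m : ℝ) - 2) / (n * (n - 1) : ℕ) * (3 / 4 * (2 * (n - 1 : ℕ) - 2))))) := by
    rintro ⟨a, b⟩ hab
    simp only [P, Finset.mem_filter, Finset.mem_univ, true_and] at hab
    obtain ⟨hne, htail⟩ := hab
    have hhead : a.val.2 ≠ b.val.2 := fun h => hne (Subtype.ext (Prod.ext htail h))
    set A : Finset (DEdge n) := {a, b} with hA
    have hAcard : A.card = 2 := Finset.card_pair hne
    set B := edgesInto a.val.2 ∪ edgesInto b.val.2 with hB
    have hdisj := disjoint_edgesInto hhead
    have hBcard : B.card = 2 * (n - 1) := by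
      rw [hB, Finset.card_union_of_disjoint hdisj, card_edgesInto, card_edgesInto, two_mul]
    have hBA : (2 * ((n - 1 : ℕ) : ℝ) - 2) ≤ (B \ A).card := by
      have h := Finset.card_le_card_sdiff_add_card (s := B) (t := A)
      rw [hBcard, hAcard] at h
      have : ((2 * (n - 1) : ℕ) : ℝ) ≤ (((B \ A).card + 2 : ℕ) : ℝ) := by exact_mod_cast h
      push_cast at this
      linarith
    have h1 : ∀ σ, (if Q (a, b) σ then (1 : ℝ) else 0) ≤ 16 ^ K *
        ((if A ⊆ graphEdges σ m then (1 : ℝ) else 0) *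
          (1 / 4) ^ ((graphEdges σ m ∩ B) \ A).card) := by
      intro σ
      by_cases hσ : Q (a, b) σ
      · rw [if_pos hσ, if_pos hσ.1, one_mul, one_div, inv_pow, ← div_eq_mul_inv,
          one_le_div (by positivity)]
        have : ((graphEdges σ m ∩ B) \ A).card ≤ 2 * K := by
          refine (Finset.card_le_card Finset.sdiff_subset).trans ?_
          rw [hB, Finset.inter_union_distrib_left, ← inEdges_eq, ← inEdges_eq]
          refine (Finset.card_union_le _ _).trans ?_
          have := hσ.2
          dsimp only at this
          omega
        calc (4 : ℝ) ^ ((graphEdges σ m ∩ B) \ A).card ≤ 4 ^ (2 * K) :=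
              pow_le_pow_right₀ (by norm_num) this
          _ = 16 ^ K := by rw [pow_mul]; norm_num
      · rw [if_neg hσ]
        split_ifs <;> positivity
    rw [prob_eq_avg]
    refine le_trans (le_of_eq (congrArg avg (funext fun σ => indicator_congr Iff.rfl)))
      ((avg_mono h1).trans ?_)
    rw [avg_const_mul]
    refine mul_le_mul_of_nonneg_left ?_ (by positivity)
    refine (avg_pow_card_le hm A B (by omega) (by norm_num) (by norm_num)).trans ?_
    rw [hAcard]
    have hm2' : (0 : ℝ) ≤ (m : ℝ) - 2 := by
      have : (2 : ℝ) ≤ m := by exact_mod_cast hm2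
      linarith
    rw [show (1 : ℝ) - 1 / 4 = 3 / 4 by norm_num]
    push_cast
    gcongr
  calc _ ≤ prob (fun σ => ∃ p ∈ P, Q p σ) := by
        refine prob_mono fun σ => ?_
        rintro ⟨e, he, e', he', hne, ht, hS, hS'⟩
        refine ⟨(e, e'), by simp [P, hne, ht], ?_, mem_smallVertices.1 hS, mem_smallVertices.1 hS'⟩
        intro x hx
        simp only [Finset.mem_insert, Finset.mem_singleton] at hx
        rcases hx with rfl | rfl
        · exact he
        · exact he'
    _ ≤ ∑ p ∈ P, prob (Q p) := prob_exists_le _ _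
    _ ≤ _ := Finset.sum_le_sum hQ
    _ ≤ _ := by
      rw [Finset.sum_const, nsmul_eq_mul]
      gcongr
      exact_mod_cast hP

lemma card_edges_from_le {D F : Finset (DEdge n)} {S : Finset (Fin n)} (h : ¬ HasCherry D S)
    (hF : ∀ e ∈ F, e.val.2 ∈ S) (U : Finset (Fin n)) :
    ((D ∩ F).filter fun e => e.val.1 ∈ U).card ≤ U.card := by
  refine Finset.card_le_card_of_injOn (fun e => e.val.1) ?_ ?_
  · intro e he
    exact (Finset.mem_filter.1 he).2
  · intro e he e' he' heq
    rw [Finset.mem_coe, Finset.mem_filter, Finset.mem_inter] at he he'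
    by_contra hne
    exact h ⟨e, he.1.1, e', he'.1.1, hne, heq, hF e he.1.2, hF e' he'.1.2⟩

lemma prob_not_injOn_le {W : Type*} [Fintype W] [DecidableEq W] (fe : Fin n → DEdge n)
    (hfe : ∀ v, (fe v).val.2 = v) (S : Finset (Fin n)) :
    prob (fun g : DEdge n → W => ¬ Set.InjOn (fun v => g (fe v)) S) ≤
      (S.card : ℝ) ^ 2 / Fintype.card W := by
  classical
  calc _ ≤ prob (fun g : DEdge n → W => ∃ p ∈ S.offDiag, ∀ e ∈ ({fe p.1} : Finset (DEdge n)),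
        g e ∈ ({g (fe p.2)} : Finset W)) := by
        refine prob_mono fun g hg => ?_
        simp only [Set.InjOn, not_forall] at hg
        obtain ⟨x, hx, y, hy, hxy, hne⟩ := hg
        exact ⟨(x, y), Finset.mem_offDiag.2 ⟨hx, hy, hne⟩, by simpa using hxy⟩
    _ ≤ ∑ p ∈ S.offDiag, prob (fun g : DEdge n → W => ∀ e ∈ ({fe p.1} : Finset (DEdge n)),
        g e ∈ ({g (fe p.2)} : Finset W)) := prob_exists_le _ _
    _ ≤ ∑ p ∈ S.offDiag, (1 : ℝ) / Fintype.card W := by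
        refine Finset.sum_le_sum fun p hp => ?_
        have hne : fe p.2 ∉ ({fe p.1} : Finset (DEdge n)) := by
          rw [Finset.mem_singleton]
          intro h
          have := congrArg (fun e : DEdge n => e.val.2) h
          simp only [hfe] at this
          exact (Finset.mem_offDiag.1 hp).2.2 this.symm
        have := prob_forall_mem_le {fe p.1} (fun g : DEdge n → W => {g (fe p.2)}) 1
          (fun g g' h => by rw [h _ hne]) (fun g => by simp)
        simpa using this
    _ ≤ _ := by
        rw [Finset.sum_const, nsmul_eq_mul, mul_one_div]
        gcongr
        rw [Finset.offDiag_card, sq]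
        exact_mod_cast Nat.sub_le _ _

end SmallVertices

section Trees

variable {n : ℕ}

lemma prob_eq_zero {Ω : Type*} [Fintype Ω] {p : Ω → Prop} (h : ∀ ω, ¬ p ω) : prob p = 0 := by
  unfold prob
  rw [Nat.card_eq_zero.2 (Or.inl ⟨fun x => h x.1 x.2⟩)]
  simp

/-- The edges leaving `U`. -/
def edgesOut (U : Finset (Fin n)) : Finset (DEdge n) :=
  Finset.univ.filter fun e => e.val.1 ∈ U ∧ e.val.2 ∉ U

lemma mem_edgesOut {U : Finset (Fin n)} {e : DEdge n} :
    e ∈ edgesOut U ↔ e.val.1 ∈ U ∧ e.val.2 ∉ U := by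
  simp [edgesOut]

lemma card_edgesOut (U : Finset (Fin n)) : (edgesOut U).card = U.card * (n - U.card) := by
  have h : (edgesOut U).card = (U ×ˢ Uᶜ).card := by
    refine Finset.card_bij (fun e _ => e.val) ?_ ?_ ?_
    · intro e he
      simpa [mem_edgesOut] using he
    · exact fun e _ e' _ h => Subtype.ext h
    · rintro ⟨x, y⟩ hxy
      simp only [Finset.mem_product, Finset.mem_compl] at hxy
      exact ⟨⟨(x, y), fun h => hxy.2 ((show x = y from h) ▸ hxy.1)⟩, mem_edgesOut.2 hxy, rfl⟩
  rw [h, Finset.card_product, Finset.card_compl, Fintype.card_fin]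

lemma head_mem_of_mem_treeEdges {v : Fin n} {U : Finset (Fin n)} {par : Fin n → Fin n}
    {e : DEdge n} (he : e ∈ treeEdges v U par) : e.val.2 ∈ U ∧ e.val.2 ≠ v := by
  simp only [treeEdges, Finset.mem_filter, Finset.mem_univ, true_and] at he
  exact ⟨he.1, he.2.1⟩

/-- The weight of an edge of the digraph, for a partial tree on `U` rooted at `v`. -/
noncomputable def edgeWeight (v : Fin n) (U : Finset (Fin n)) (ρ : ℝ) (e : DEdge n) : ℝ :=
  if e ∈ edgesInto v then 0 else if e ∈ edgesOut U then ρ else 1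

/-- The weight of a partial tree. -/
noncomputable def treeWeight (m : ℕ) (ρ : ℝ) (v : Fin n) (U : Finset (Fin n))
    (par : Fin n → Fin n) (σ : Equiv.Perm (DEdge n)) : ℝ :=
  (if ∀ e ∈ treeEdges v U par, σ e ∈ earlyEdges n m then 1 else 0) *
    ∏ e ∈ (treeEdges v U par)ᶜ, (if σ e ∈ earlyEdges n m then edgeWeight v U ρ e else 1)

lemma edgeWeight_nonneg {ρ : ℝ} (hρ0 : 0 ≤ ρ) (v : Fin n) (U : Finset (Fin n)) (e : DEdge n) :
    0 ≤ edgeWeight v U ρ e := by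
  unfold edgeWeight
  split_ifs <;> linarith

lemma edgeWeight_le_one {ρ : ℝ} (hρ1 : ρ ≤ 1) (v : Fin n) (U : Finset (Fin n)) (e : DEdge n) :
    edgeWeight v U ρ e ≤ 1 := by
  unfold edgeWeight
  split_ifs <;> linarith

lemma treeWeight_nonneg {ρ : ℝ} (hρ0 : 0 ≤ ρ) (m : ℕ) (v : Fin n) (U : Finset (Fin n))
    (par : Fin n → Fin n) (σ : Equiv.Perm (DEdge n)) : 0 ≤ treeWeight m ρ v U par σ := by
  unfold treeWeight
  refine mul_nonneg (by split_ifs <;> norm_num) (Finset.prod_nonneg fun e _ => ?_)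
  split_ifs
  · exact edgeWeight_nonneg hρ0 v U e
  · exact zero_le_one

lemma avg_treeWeight_le {m : ℕ} (hm : m ≤ n * (n - 1)) {ρ : ℝ} (hρ0 : 0 ≤ ρ) (hρ1 : ρ ≤ 1)
    {v : Fin n} {U : Finset (Fin n)} {par : Fin n → Fin n} (h : IsParentMap v U par)
    (hU : U.card ≤ m) :
    avg (treeWeight m ρ v U par) ≤ ((m : ℝ) / (n * (n - 1) : ℕ)) ^ (U.card - 1) *
      Real.exp (-(((m : ℝ) - (U.card - 1 : ℕ)) / (n * (n - 1) : ℕ) *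
        ((n - 1 : ℕ) + (1 - ρ) * (U.card * (n - U.card) : ℕ)))) := by
  have hcard := card_treeEdges h
  have h1 := avg_prod_weight_le (earlyEdges n m) (treeEdges v U par)
    (by rw [card_earlyEdges hm]; omega) (edgeWeight v U ρ) (edgeWeight_nonneg hρ0 v U)
    (edgeWeight_le_one hρ1 v U)
  rw [card_earlyEdges hm, card_dEdge, hcard] at h1
  have hdisj : Disjoint (edgesInto v) (edgesOut U) := by
    rw [Finset.disjoint_left]
    intro e he he'
    rw [mem_edgesInto] at he
    exact (mem_edgesOut.1 he').2 (he ▸ h.1)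
  have hsub : edgesInto v ∪ edgesOut U ⊆ (treeEdges v U par)ᶜ := by
    intro e he
    rw [Finset.mem_compl]
    intro he'
    obtain ⟨h2, h3⟩ := head_mem_of_mem_treeEdges he'
    rcases Finset.mem_union.1 he with he | he
    · exact h3 (mem_edgesInto.1 he)
    · exact (mem_edgesOut.1 he).2 h2
  have h2 : ((n - 1 : ℕ) + (1 - ρ) * (U.card * (n - U.card) : ℕ) : ℝ) ≤
      ∑ e ∈ (treeEdges v U par)ᶜ, (1 - edgeWeight v U ρ e) := by
    refine le_trans (le_of_eq ?_) (Finset.sum_le_sum_of_subset_of_nonneg hsub fun e _ _ =>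
      sub_nonneg.2 (edgeWeight_le_one hρ1 v U e))
    rw [Finset.sum_union hdisj, ← card_edgesInto v, ← card_edgesOut]
    have ha : ∀ e ∈ edgesInto v, 1 - edgeWeight v U ρ e = 1 := by
      intro e he
      simp [edgeWeight, he]
    have hb : ∀ e ∈ edgesOut U, 1 - edgeWeight v U ρ e = 1 - ρ := by
      intro e he
      simp [edgeWeight, he, Finset.disjoint_right.1 hdisj he]
    rw [Finset.sum_congr rfl ha, Finset.sum_congr rfl hb]
    simp only [Finset.sum_const, nsmul_eq_mul]
    ring
  refine h1.trans ?_
  have hmU : (0 : ℝ) ≤ (m : ℝ) - (U.card - 1 : ℕ) := by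
    rw [sub_nonneg]
    exact_mod_cast (Nat.sub_le _ _).trans hU
  gcongr

/-- A partial tree that cannot be extended. -/
def TreeStuck (m : ℕ) (W₂ : Finset (Colour n)) (F : Finset (DEdge n)) (v : Fin n)
    (U : Finset (Fin n)) (par : Fin n → Fin n) (ω : SampleSpace n) : Prop :=
  InDegreeZero ω m v ∧ treeEdges v U par ⊆ graphEdges ω.1 m ∧
    ∀ e ∈ (graphEdges ω.1 m ∩ edgesOut U) \ F, ω.2 e ∈ W₂ᶜ ∪ (treeEdges v U par ∪ F).image ω.2

lemma prob_treeStuck_le (m : ℕ) (W₂ : Finset (Colour n)) (F : Finset (DEdge n))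
    (S : Finset (Fin n)) (hF : ∀ e ∈ F, e.val.2 ∈ S) (σ : Equiv.Perm (DEdge n))
    (hS : ¬ HasCherry (graphEdges σ m) S) (v : Fin n) (U : Finset (Fin n))
    (par : Fin n → Fin n) (b : ℕ) (hb : W₂ᶜ.card + U.card + F.card ≤ b)
    (hb0 : 0 < b) (hbw : b ≤ numColours n) :
    prob (fun g : DEdge n → Colour n => TreeStuck m W₂ F v U par (σ, g)) ≤
      ((b : ℝ) / numColours n)⁻¹ ^ U.card *
        treeWeight m ((b : ℝ) / numColours n) v U par σ := by
  set ρ : ℝ := (b : ℝ) / numColours n with hρ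
  have hw0 : (0 : ℝ) < numColours n := by exact_mod_cast hb0.trans_le hbw
  have hb0' : (0 : ℝ) < b := by exact_mod_cast hb0
  have hρ0 : 0 < ρ := div_pos hb0' hw0
  have hρ1 : ρ ≤ 1 := div_le_one_of_le₀ (by exact_mod_cast hbw) hw0.le
  set D := graphEdges σ m with hD
  by_cases hv : ∀ e ∈ edgesInto v, σ e ∉ earlyEdges n m
  swap
  · have : prob (fun g : DEdge n → Colour n => TreeStuck m W₂ F v U par (σ, g)) = 0 :=
      prob_eq_zero fun g hg => hv (inDegreeZero_iff.1 hg.1)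
    rw [this]
    exact mul_nonneg (by positivity) (treeWeight_nonneg hρ0.le _ _ _ _ _)
  by_cases hT : treeEdges v U par ⊆ D
  swap
  · have : prob (fun g : DEdge n → Colour n => TreeStuck m W₂ F v U par (σ, g)) = 0 :=
      prob_eq_zero fun g hg => hT hg.2.1
    rw [this]
    exact mul_nonneg (by positivity) (treeWeight_nonneg hρ0.le _ _ _ _ _)
  have hweight : treeWeight m ρ v U par σ = ρ ^ ((D ∩ edgesOut U) \ treeEdges v U par).card := by
    rw [treeWeight, if_pos (fun e he => mem_graphEdges.1 (hT he)), one_mul, ← prod_weight_eq]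
    refine Finset.prod_congr rfl fun e _ => ?_
    by_cases he : σ e ∈ earlyEdges n m
    · have he1 : e ∉ edgesInto v := fun h => hv e h he
      have he2 : e ∈ D := mem_graphEdges.2 he
      rw [if_pos he, if_pos he2, edgeWeight, if_neg he1]
    · have he2 : e ∉ D := fun h => he (mem_graphEdges.1 h)
      rw [if_neg he, if_neg he2]
  have hcount : ((D ∩ edgesOut U) \ treeEdges v U par).card ≤
      ((D ∩ edgesOut U) \ F).card + U.card := by
    calc _ ≤ (D ∩ edgesOut U).card := Finset.card_le_card Finset.sdiff_subset
      _ ≤ (((D ∩ edgesOut U) \ F) ∪ ((D ∩ F).filter fun e => e.val.1 ∈ U)).card := by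
        refine Finset.card_le_card fun e he => ?_
        simp only [Finset.mem_union, Finset.mem_sdiff, Finset.mem_filter, Finset.mem_inter,
          mem_edgesOut] at he ⊢
        tauto
      _ ≤ _ := (Finset.card_union_le _ _).trans
        (Nat.add_le_add_left (card_edges_from_le hS hF U) _)
  have hprob : prob (fun g : DEdge n → Colour n => TreeStuck m W₂ F v U par (σ, g)) ≤
      ρ ^ ((D ∩ edgesOut U) \ F).card := by
    have h := prob_forall_mem_le ((D ∩ edgesOut U) \ F)
      (fun g : DEdge n → Colour n => W₂ᶜ ∪ (treeEdges v U par ∪ F).image g) b ?_ ?_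
    · rw [Fintype.card_fin] at h
      exact (prob_mono fun g hg => hg.2.2).trans h
    · intro g g' hgg
      congr 1
      refine Finset.image_congr fun e he => hgg e fun he' => ?_
      simp only [Finset.mem_sdiff, Finset.mem_inter, mem_edgesOut] at he'
      rcases Finset.mem_union.1 (Finset.mem_coe.1 he) with h | h
      · exact he'.1.2.2 (head_mem_of_mem_treeEdges h).1
      · exact he'.2 h
    · intro g
      calc _ ≤ W₂ᶜ.card + (treeEdges v U par ∪ F).card :=
            (Finset.card_union_le _ _).trans (Nat.add_le_add_left Finset.card_image_le _)
        _ ≤ W₂ᶜ.card + (U.card + F.card) := Nat.add_le_add_left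
            ((Finset.card_union_le _ _).trans
              (Nat.add_le_add_right (card_treeEdges_le v U par) _)) _
        _ ≤ b := by omega
  refine hprob.trans ?_
  rw [hweight, inv_pow, inv_mul_eq_div, le_div_iff₀ (by positivity), ← pow_add]
  exact pow_le_pow_of_le_one hρ0.le hρ1 hcount

/-- The expected number of trees on `t` vertices that cannot be extended, up to a constant. -/
noncomputable def treeTerm (n m : ℕ) (ρ : ℝ) (t : ℕ) : ℝ :=
  n.choose t * (t * ((t : ℝ) ^ (t - 1) * (ρ⁻¹ ^ t * (((m : ℝ) / (n * (n - 1) : ℕ)) ^ (t - 1) *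
    Real.exp (-(((m : ℝ) - (t - 1 : ℕ)) / (n * (n - 1) : ℕ) *
      ((n - 1 : ℕ) + (1 - ρ) * (t * (n - t) : ℕ))))))))

lemma prob_not_treesExtend_le {m t₀ q b : ℕ} (hm : m ≤ n * (n - 1)) (K : ℕ) (ht₀ : t₀ ≤ m)
    (W₂ : Finset (Colour n)) (fe : Equiv.Perm (DEdge n) → Fin n → DEdge n)
    (hfe : ∀ σ v, (fe σ v).val.2 = v) (hb : W₂ᶜ.card + t₀ + q ≤ b)
    (hb0 : 0 < b) (hbw : b ≤ numColours n) :
    prob (fun ω : SampleSpace n => (smallVertices ω.1 m K).card ≤ q ∧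
      ¬ HasCherry (graphEdges ω.1 m) (smallVertices ω.1 m K) ∧
      ¬ TreesExtend m t₀ W₂ ((smallVertices ω.1 m K).image (fe ω.1)) ω) ≤
    ∑ t ∈ Finset.Ico 1 t₀, treeTerm n m ((b : ℝ) / numColours n) t := by
  classical
  set ρ : ℝ := (b : ℝ) / numColours n with hρ
  have hw0 : (0 : ℝ) < numColours n := by exact_mod_cast hb0.trans_le hbw
  have hb0' : (0 : ℝ) < b := by exact_mod_cast hb0
  have hρ0 : 0 < ρ := div_pos hb0' hw0
  have hρ1 : ρ ≤ 1 := div_le_one_of_le₀ (by exact_mod_cast hbw) hw0.le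
  let J : Finset (Σ _ : ℕ, Σ _ : Finset (Fin n), Σ _ : Fin n, (Fin n → Fin n)) :=
    (Finset.Ico 1 t₀).sigma fun t => (Finset.powersetCard t Finset.univ).sigma fun U =>
      U.sigma fun v => parentMaps v U
  let Y : (Σ _ : ℕ, Σ _ : Finset (Fin n), Σ _ : Fin n, (Fin n → Fin n)) →
      Equiv.Perm (DEdge n) → ℝ := fun j σ =>
    if IsParentMap j.2.2.1 j.2.1 j.2.2.2 then
      ρ⁻¹ ^ j.1 * treeWeight m ρ j.2.2.1 j.2.1 j.2.2.2 σ else 0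
  have hY0 : ∀ j σ, 0 ≤ Y j σ := by
    intro j σ
    simp only [Y]
    split_ifs
    · exact mul_nonneg (by positivity) (treeWeight_nonneg hρ0.le _ _ _ _ _)
    · exact le_rfl
  refine (prob_prod_le _ (fun σ => ∑ j ∈ J, Y j σ) fun σ => ?_).trans ?_
  · set S := smallVertices σ m K with hS
    by_cases hgood : S.card ≤ q ∧ ¬ HasCherry (graphEdges σ m) S
    swap
    · refine le_trans (le_of_eq ?_) (Finset.sum_nonneg fun j _ => hY0 j σ)
      exact prob_eq_zero fun g h => hgood ⟨h.1, h.2.1⟩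
    obtain ⟨hSq, hcherry⟩ := hgood
    calc _ ≤ prob (fun g : DEdge n → Colour n => ∃ j ∈ J, IsParentMap j.2.2.1 j.2.1 j.2.2.2 ∧
          TreeStuck m W₂ (S.image (fe σ)) j.2.2.1 j.2.1 j.2.2.2 (σ, g)) := by
          refine prob_mono fun g hg => ?_
          obtain ⟨-, -, hg⟩ := hg
          unfold TreesExtend at hg
          push Not at hg
          obtain ⟨v, hv, U, par, hpar, hU, hT, hstuck⟩ := hg
          refine ⟨⟨U.card, U, v, par⟩, ?_, hpar, hv, hT, ?_⟩
          · simp only [J, Finset.mem_sigma, Finset.mem_Ico, Finset.mem_powersetCard,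
              Finset.subset_univ, true_and, and_true]
            exact ⟨⟨Finset.card_pos.2 ⟨v, hpar.1⟩, hU⟩, hpar.1, hpar.2.1⟩
          · intro e he
            simp only [Finset.mem_sdiff, Finset.mem_inter, mem_edgesOut] at he
            exact hstuck e he.1.1 ⟨he.1.2.1, he.1.2.2, he.2⟩
      _ ≤ ∑ j ∈ J, prob (fun g : DEdge n → Colour n => IsParentMap j.2.2.1 j.2.1 j.2.2.2 ∧
          TreeStuck m W₂ (S.image (fe σ)) j.2.2.1 j.2.1 j.2.2.2 (σ, g)) := prob_exists_le _ _
      _ ≤ ∑ j ∈ J, Y j σ := by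
          refine Finset.sum_le_sum ?_
          rintro ⟨t, U, v, par⟩ hj
          simp only [J, Finset.mem_sigma, Finset.mem_Ico, Finset.mem_powersetCard,
            Finset.subset_univ, true_and] at hj
          obtain ⟨⟨ht1, htt⟩, rfl, -, -⟩ := hj
          simp only [Y]
          by_cases hpar : IsParentMap v U par
          · rw [if_pos hpar]
            refine (prob_mono fun g hg => hg.2).trans ?_
            have hFc : (S.image (fe σ)).card ≤ q := Finset.card_image_le.trans hSq
            refine prob_treeStuck_le m W₂ _ S ?_ σ hcherry v U par b (by omega) hb0 hbw
            intro e he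
            obtain ⟨x, hx, rfl⟩ := Finset.mem_image.1 he
            rwa [hfe]
          · rw [if_neg hpar]
            simp [prob, hpar]
  · rw [avg_sum]
    calc ∑ j ∈ J, avg (Y j) ≤ ∑ j ∈ J, (ρ⁻¹ ^ j.1 * (((m : ℝ) / (n * (n - 1) : ℕ)) ^ (j.1 - 1) *
          Real.exp (-(((m : ℝ) - (j.1 - 1 : ℕ)) / (n * (n - 1) : ℕ) *
            ((n - 1 : ℕ) + (1 - ρ) * (j.1 * (n - j.1) : ℕ)))))) := by
          refine Finset.sum_le_sum ?_
          rintro ⟨t, U, v, par⟩ hj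
          simp only [J, Finset.mem_sigma, Finset.mem_Ico, Finset.mem_powersetCard,
            Finset.subset_univ, true_and] at hj
          obtain ⟨⟨ht1, htt⟩, rfl, -, -⟩ := hj
          simp only [Y]
          by_cases hpar : IsParentMap v U par
          · simp only [hpar, if_true]
            rw [avg_const_mul]
            exact mul_le_mul_of_nonneg_left
              (avg_treeWeight_le hm hρ0.le hρ1 hpar (by omega)) (by positivity)
          · simp only [hpar, if_false]
            rw [avg_const]
            positivity
      _ = ∑ t ∈ Finset.Ico 1 t₀, treeTerm n m ρ t := by
          rw [Finset.sum_sigma]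
          refine Finset.sum_congr rfl fun t _ => ?_
          rw [Finset.sum_sigma]
          have : ∀ U ∈ Finset.powersetCard t (Finset.univ : Finset (Fin n)), ∀ c : ℝ,
              ∑ _x ∈ U.sigma fun v => parentMaps v U, c = t * ((t : ℝ) ^ (t - 1) * c) := by
            intro U hU c
            rw [Finset.sum_sigma]
            have h1 : ∀ v ∈ U, ∑ _par ∈ parentMaps v U, c = (t : ℝ) ^ (t - 1) * c := by
              intro v hv
              rw [Finset.sum_const, card_parentMaps hv, (Finset.mem_powersetCard.1 hU).2,
                nsmul_eq_mul, Nat.cast_pow]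
            rw [Finset.sum_congr rfl h1, Finset.sum_const, (Finset.mem_powersetCard.1 hU).2,
              nsmul_eq_mul]
          dsimp only
          refine (Finset.sum_congr rfl fun U hU => this U hU _).trans ?_
          rw [Finset.sum_const,
            Finset.card_powersetCard, Finset.card_univ, Fintype.card_fin, nsmul_eq_mul]
          rfl

end Trees

section Hall

variable {n : ℕ}

/-- The expected number of violations of Hall's condition by `s` vertices. -/
noncomputable def hallTerm (n w a K s : ℕ) : ℝ :=
  n.choose s * (w.choose s * (((a + s : ℕ) : ℝ) / w) ^ (K * s))

lemma prob_not_hallOutside_le {q : ℕ} (m K : ℕ) (W₂ : Finset (Colour n))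
    (fe : Equiv.Perm (DEdge n) → Fin n → DEdge n)
    (hfe : ∀ σ v, (fe σ v).val.2 = v) (hw : W₂.card + q + n ≤ numColours n) :
    prob (fun ω : SampleSpace n => (smallVertices ω.1 m K).card ≤ q ∧
      ¬ HallOutside m W₂ (smallVertices ω.1 m K) ((smallVertices ω.1 m K).image (fe ω.1)) ω) ≤
    ∑ s ∈ Finset.Icc 1 n, hallTerm n (numColours n) (W₂.card + q) K s := by
  classical
  refine (prob_prod_le _ (fun _ => ∑ s ∈ Finset.Icc 1 n,
    hallTerm n (numColours n) (W₂.card + q) K s) fun σ => ?_).trans (avg_const _).le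
  set S := smallVertices σ m K with hS
  set F := S.image (fe σ) with hF
  set D := graphEdges σ m with hD
  set T := ∑ s ∈ Finset.Icc 1 n, hallTerm n (numColours n) (W₂.card + q) K s with hT
  have hT0 : 0 ≤ T := Finset.sum_nonneg fun s _ => by unfold hallTerm; positivity
  by_cases hSq : S.card ≤ q
  swap
  · exact (prob_eq_zero fun g h => hSq h.1).trans_le hT0
  let J : Finset (Σ _ : ℕ, Finset (Fin n) × Finset (Colour n)) :=
    (Finset.Icc 1 n).sigma fun s =>
      (Finset.powersetCard s Finset.univ) ×ˢ (Finset.powersetCard s Finset.univ)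
  let Q : (Σ _ : ℕ, Finset (Fin n) × Finset (Colour n)) → (DEdge n → Colour n) → Prop :=
    fun j g => Disjoint j.2.1 S ∧ ∀ e ∈ D.filter (fun e => e.val.2 ∈ j.2.1),
      g e ∈ W₂ ∪ j.2.2 ∪ F.image g
  have hQ : ∀ j ∈ J, prob (Q j) ≤
      (((W₂.card + q + j.1 : ℕ) : ℝ) / numColours n) ^ (K * j.1) := by
    rintro ⟨s, A, R⟩ hj
    simp only [J, Finset.mem_sigma, Finset.mem_Icc, Finset.mem_product, Finset.mem_powersetCard,
      Finset.subset_univ, true_and] at hj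
    obtain ⟨⟨hs1, hsn⟩, hA, hR⟩ := hj
    dsimp only
    by_cases hAS : Disjoint A S
    swap
    · refine (prob_eq_zero fun g h => hAS h.1).trans_le (by positivity)
    have hle1 : ((W₂.card + q + s : ℕ) : ℝ) / numColours n ≤ 1 :=
      div_le_one_of_le₀ (by exact_mod_cast (by omega)) (Nat.cast_nonneg _)
    have hM : K * s ≤ (D.filter (fun e => e.val.2 ∈ A)).card := by
      rw [Finset.card_eq_sum_card_fiberwise (f := fun e : DEdge n => e.val.2)
        (s := D.filter fun e => e.val.2 ∈ A) (t := A) (fun e he => (Finset.mem_filter.1 he).2), ← hA,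
        mul_comm, ← smul_eq_mul]
      refine Finset.card_nsmul_le_sum _ _ _ fun v hv => ?_
      have h1 : v ∉ S := Finset.disjoint_left.1 hAS hv
      rw [hS, mem_smallVertices, not_lt] at h1
      refine h1.trans (Finset.card_le_card fun e he => ?_)
      simp only [inEdges, Finset.mem_filter] at he ⊢
      exact ⟨⟨he.1, he.2 ▸ hv⟩, he.2⟩
    have h := prob_forall_mem_le (D.filter (fun e => e.val.2 ∈ A))
      (fun g : DEdge n → Colour n => W₂ ∪ R ∪ F.image g) (W₂.card + q + s) ?_ ?_
    · rw [Fintype.card_fin] at h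
      exact (prob_mono fun g hg => hg.2).trans
        (h.trans (pow_le_pow_of_le_one (by positivity) hle1 hM))
    · intro g g' hgg
      congr 1
      refine Finset.image_congr fun e he => hgg e fun he' => ?_
      obtain ⟨x, hx, rfl⟩ := Finset.mem_image.1 (Finset.mem_coe.1 he)
      have h2 := (Finset.mem_filter.1 he').2
      rw [hfe] at h2
      exact Finset.disjoint_left.1 hAS h2 hx
    · intro g
      have h1 : (F.image g).card ≤ q :=
        Finset.card_image_le.trans (Finset.card_image_le.trans hSq)
      have h2 := Finset.card_union_le (W₂ ∪ R) (F.image g)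
      have h3 := Finset.card_union_le W₂ R
      omega
  calc _ ≤ prob (fun g : DEdge n → Colour n => ∃ j ∈ J, Q j g) := by
        refine prob_mono fun g hg => ?_
        obtain ⟨-, hg⟩ := hg
        unfold HallOutside at hg
        push Not at hg
        obtain ⟨A, hAne, hAS, R, hR, hbad⟩ := hg
        refine ⟨⟨A.card, A, R⟩, ?_, hAS, ?_⟩
        · simp only [J, Finset.mem_sigma, Finset.mem_Icc, Finset.mem_product,
            Finset.mem_powersetCard, Finset.subset_univ, true_and, and_true]
          exact ⟨⟨Finset.card_pos.2 hAne, (Finset.card_le_univ A).trans_eq (by simp)⟩, hR⟩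
        · intro e he
          exact hbad e (Finset.mem_filter.1 he).1 (Finset.mem_filter.1 he).2
    _ ≤ ∑ j ∈ J, prob (Q j) := prob_exists_le _ _
    _ ≤ ∑ j ∈ J, (((W₂.card + q + j.1 : ℕ) : ℝ) / numColours n) ^ (K * j.1) :=
        Finset.sum_le_sum hQ
    _ = T := by
        rw [Finset.sum_sigma]
        refine Finset.sum_congr rfl fun s _ => ?_
        dsimp only
        rw [Finset.sum_const, Finset.card_product, Finset.card_powersetCard,
          Finset.card_powersetCard, Finset.card_univ, Finset.card_univ, Fintype.card_fin,
          Fintype.card_fin, nsmul_eq_mul, Nat.cast_mul, mul_assoc]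
        rfl

/-- A nonasymptotic lower bound for the probability of the main event. -/
lemma le_prob_assignment_and_arborescence (hn : 2 ≤ n) {m K q w₂ b t₀ : ℕ}
    (hm : m + 2 * (n - 1) ≤ n * (n - 1)) (hm2 : 2 ≤ m) (ht₀m : t₀ ≤ m) (ht₀ : 1 ≤ t₀)
    (hK : 1 ≤ K) (hq : 1 ≤ q) (hμ : 1 < meanZero n m)
    (hw : w₂ + q + n ≤ numColours n) (hb : numColours n - w₂ + t₀ + q ≤ b)
    (hbw : b ≤ numColours n) :
    1 - (meanZero n m / (meanZero n m - 1) ^ 2 +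
      (n * (4 ^ K * Real.exp (-((m : ℝ) / (n * (n - 1) : ℕ) * (3 / 4 * (n - 1 : ℕ)))))) / q +
      (n : ℝ) ^ 3 * (16 ^ K * (((m : ℝ) / (n * (n - 1) : ℕ)) ^ 2 *
        Real.exp (-(((m : ℝ) - 2) / (n * (n - 1) : ℕ) * (3 / 4 * (2 * (n - 1 : ℕ) - 2)))))) +
      (q : ℝ) ^ 2 / numColours n +
      ∑ t ∈ Finset.Ico 1 t₀, treeTerm n m ((b : ℝ) / numColours n) t +
      ∑ s ∈ Finset.Icc 1 n, hallTerm n (numColours n) (w₂ + q) K s) ≤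
    prob (fun ω : SampleSpace n => ∃ (T : Set (Colour n)) (u : Fin n) (f : Fin n → Colour n),
      T.ncard = n - 1 ∧
      Set.BijOn f {v : Fin n | v ≠ u} T ∧
      (∀ v : Fin n, v ≠ u → ∃ e : DEdge n,
        inProcess ω (hitTime n (ZEvent ω)) e ∧ e.val.2 = v ∧ ω.2 e = f v) ∧
      ∃ A : Set (DEdge n),
        (∀ e ∈ A, inProcess ω (hitTime n (ZEvent ω)) e) ∧
        IsArborescenceRootedAt A u ∧
        Set.InjOn ω.2 A ∧
        (∀ e ∈ A, ω.2 e ∉ T) ∧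
        t₀ ≤ ({u} ∪ {v : Fin n | ∃ e ∈ A, (e : DEdge n).val.2 = v}).ncard) := by
  classical
  have hmN : m ≤ n * (n - 1) := by omega
  have hfe : ∀ (σ : Equiv.Perm (DEdge n)) (v : Fin n), ∃ e : DEdge n, e.val.2 = v ∧
      ∀ e' : DEdge n, e'.val.2 = v → (Fintype.equivFin (DEdge n) (σ e)).val ≤
        (Fintype.equivFin (DEdge n) (σ e')).val := by
    intro σ v
    obtain ⟨e₀, he₀⟩ := exists_edge_to hn v
    obtain ⟨e, he, hmin⟩ := Finset.exists_min_image (edgesInto v)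
      (fun e => (Fintype.equivFin (DEdge n) (σ e)).val) ⟨e₀, mem_edgesInto.2 he₀⟩
    exact ⟨e, mem_edgesInto.1 he, fun e' he' => hmin e' (mem_edgesInto.2 he')⟩
  choose fe hfe hfe' using hfe
  obtain ⟨W₂, -, hW₂⟩ := Finset.exists_subset_card_eq (s := (Finset.univ : Finset (Colour n)))
    (n := w₂) (by rw [Finset.card_univ, Fintype.card_fin]; omega)
  have hne : Nonempty (Colour n) := ⟨⟨0, by omega⟩⟩
  have hcompl : W₂ᶜ.card = numColours n - w₂ := by
    rw [Finset.card_compl, Fintype.card_fin, hW₂]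
  let B1 : SampleSpace n → Prop := fun ω => ZEvent ω m
  let B2 : SampleSpace n → Prop := fun ω => (q : ℝ) < ((smallVertices ω.1 m K).card : ℝ)
  let B3 : SampleSpace n → Prop := fun ω => HasCherry (graphEdges ω.1 m) (smallVertices ω.1 m K)
  let B4 : SampleSpace n → Prop := fun ω => (smallVertices ω.1 m K).card ≤ q ∧
    ¬ Set.InjOn (fun v => ω.2 (fe ω.1 v)) (smallVertices ω.1 m K)
  let B5 : SampleSpace n → Prop := fun ω => (smallVertices ω.1 m K).card ≤ q ∧
      ¬ HasCherry (graphEdges ω.1 m) (smallVertices ω.1 m K) ∧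
      ¬ TreesExtend m t₀ W₂ ((smallVertices ω.1 m K).image (fe ω.1)) ω
  let B6 : SampleSpace n → Prop := fun ω => (smallVertices ω.1 m K).card ≤ q ∧
      ¬ HallOutside m W₂ (smallVertices ω.1 m K) ((smallVertices ω.1 m K).image (fe ω.1)) ω
  have h1 : prob B1 ≤ _ := prob_zEvent_le hm hμ
  have h2 : prob B2 ≤ (n * (4 ^ K *
      Real.exp (-((m : ℝ) / (n * (n - 1) : ℕ) * (3 / 4 * (n - 1 : ℕ)))))) / q := by
    refine (prob_fst_le (fun σ : Equiv.Perm (DEdge n) =>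
      (q : ℝ) < ((smallVertices σ m K).card : ℝ))).trans ?_
    refine (prob_lt_le_avg_div (fun σ => Nat.cast_nonneg _) (by exact_mod_cast hq)).trans ?_
    gcongr
    exact avg_card_smallVertices_le hmN K
  have h3 : prob B3 ≤ _ := (prob_fst_le (fun σ : Equiv.Perm (DEdge n) =>
    HasCherry (graphEdges σ m) (smallVertices σ m K))).trans (prob_hasCherry_le hmN hm2 K)
  have h4 : prob B4 ≤ (q : ℝ) ^ 2 / numColours n := by
    refine (prob_prod_le _ (fun _ => (q : ℝ) ^ 2 / numColours n) fun σ => ?_).trans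
      (avg_const _).le
    by_cases hS : (smallVertices σ m K).card ≤ q
    · refine (prob_mono fun g hg => hg.2).trans
        ((prob_not_injOn_le (fe σ) (hfe σ) (smallVertices σ m K)).trans ?_)
      rw [Fintype.card_fin]
      gcongr
    · exact (prob_eq_zero fun g h => hS h.1).trans_le (by positivity)
  have h5 : prob B5 ≤ _ := prob_not_treesExtend_le hmN K ht₀m W₂ fe hfe
    (by rw [hcompl]; exact hb) (by omega) hbw
  have h6 : prob B6 ≤ _ := prob_not_hallOutside_le m K W₂ fe hfe (by rw [hW₂]; exact hw)
  rw [hW₂] at h6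
  have hbad := (prob_or_le (fun ω => ((((B1 ω ∨ B2 ω) ∨ B3 ω) ∨ B4 ω) ∨ B5 ω)) B6).trans
    (add_le_add_left ((prob_or_le (fun ω => (((B1 ω ∨ B2 ω) ∨ B3 ω) ∨ B4 ω)) B5).trans
      (add_le_add_left ((prob_or_le (fun ω => ((B1 ω ∨ B2 ω) ∨ B3 ω)) B4).trans
        (add_le_add_left ((prob_or_le (fun ω => (B1 ω ∨ B2 ω)) B3).trans
          (add_le_add_left (prob_or_le B1 B2) _)) _)) _)) _)
  refine le_trans ?_ (one_sub_prob_not_le _)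
  have hsub := prob_mono (Ω := SampleSpace n) (p := fun ω => ¬ _)
    (q := fun ω => (((((B1 ω ∨ B2 ω) ∨ B3 ω) ∨ B4 ω) ∨ B5 ω) ∨ B6 ω)) fun ω hω => by
      by_contra hgood
      simp only [not_or] at hgood
      obtain ⟨⟨⟨⟨⟨g1, g2⟩, g3⟩, g4⟩, g5⟩, g6⟩ := hgood
      have hSq : (smallVertices ω.1 m K).card ≤ q := by exact_mod_cast not_lt.1 g2
      refine hω (exists_assignment_and_arborescence hn ω m K t₀ (by omega) hK ht₀ W₂ (fe ω.1)
        (hfe ω.1) (fun e => hfe' ω.1 e.val.2 e rfl) g1 ?_ ?_ ?_)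
      · by_contra h; exact g4 ⟨hSq, h⟩
      · by_contra h; exact g5 ⟨hSq, g3, h⟩
      · by_contra h; exact g6 ⟨hSq, h⟩
  linarith

end Hall

section Asymptotics

/-- The quantitative conditions on `n` used in the estimates. -/
structure LargeEnough (n : ℕ) : Prop where
  logLog : 8 * Real.exp 81 ≤ Real.log (Real.log n)
  eps_le : eps n ≤ Real.exp (-81) / 100
  logSq : 12 * Real.log n ^ 2 ≤ n
  root : (n : ℝ) ^ ((2 : ℝ) / 3) + (n : ℝ) ^ ((2 : ℝ) / 5) + 3 ≤ eps n * n

/-- The number of edges at which the digraph is inspected. -/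
noncomputable def numEdges (n : ℕ) : ℕ := ⌊(n : ℝ) * (Real.log n - Real.log (Real.log n))⌋₊

/-- Vertices with smaller in-degree are treated separately. -/
noncomputable def degreeBound (n : ℕ) : ℕ := ⌈Real.log n / 20⌉₊

/-- The bound for the number of vertices of small in-degree. -/
noncomputable def smallBound (n : ℕ) : ℕ := ⌈(n : ℝ) ^ ((2 : ℝ) / 5)⌉₊

/-- The number of colours reserved for the tree. -/
noncomputable def numTreeColours (n : ℕ) : ℕ := ⌊25 * eps n * n⌋₊

lemma tendsto_log_natCast : Tendsto (fun n : ℕ => Real.log n) atTop atTop :=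
  Real.tendsto_log_atTop.comp tendsto_natCast_atTop_atTop

lemma eventually_largeEnough : ∀ᶠ n : ℕ in atTop, LargeEnough n := by
  have h1 : ∀ᶠ n : ℕ in atTop, 8 * Real.exp 81 ≤ Real.log (Real.log n) :=
    (Real.tendsto_log_atTop.comp tendsto_log_natCast).eventually_ge_atTop _
  have h2 : ∀ᶠ n : ℕ in atTop, eps n ≤ Real.exp (-81) / 100 := by
    have h := (Real.isLittleO_log_id_atTop.comp_tendsto tendsto_log_natCast).tendsto_div_nhds_zero
    exact h.eventually_le_const (by positivity)
  have h3 : ∀ᶠ n : ℕ in atTop, 12 * Real.log n ^ 2 ≤ n := by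
    have h := (isLittleO_log_rpow_atTop (r := 1 / 2) (by norm_num)).comp_tendsto
      (tendsto_natCast_atTop_atTop (R := ℝ))
    have h' := h.bound (c := 1 / 4) (by norm_num)
    filter_upwards [h', eventually_ge_atTop 1] with n hn hn1
    have hn1' : (1 : ℝ) ≤ n := by exact_mod_cast hn1
    simp only [Function.comp_apply, Real.norm_eq_abs] at hn
    rw [abs_of_nonneg (Real.log_nonneg hn1'), abs_of_nonneg (by positivity)] at hn
    have hsq : ((n : ℝ) ^ ((1 : ℝ) / 2)) ^ 2 = n := by
      rw [← Real.rpow_natCast, ← Real.rpow_mul (by positivity)]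
      norm_num
    have hlog := Real.log_nonneg hn1'
    nlinarith
  have h4 : ∀ᶠ n : ℕ in atTop, 5 * Real.log n ≤ (n : ℝ) ^ ((1 : ℝ) / 3) := by
    have h := (isLittleO_log_rpow_atTop (r := 1 / 3) (by norm_num)).comp_tendsto
      (tendsto_natCast_atTop_atTop (R := ℝ))
    have h' := h.bound (c := 1 / 5) (by norm_num)
    filter_upwards [h', eventually_ge_atTop 1] with n hn hn1
    have hn1' : (1 : ℝ) ≤ n := by exact_mod_cast hn1
    simp only [Function.comp_apply, Real.norm_eq_abs] at hn
    rw [abs_of_nonneg (Real.log_nonneg hn1'), abs_of_nonneg (by positivity)] at hn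
    linarith
  filter_upwards [h1, h2, h3, h4, eventually_ge_atTop 2] with n h1 h2 h3 h4 hn
  refine ⟨h1, h2, h3, ?_⟩
  have hn1 : (1 : ℝ) ≤ n := by exact_mod_cast (by omega : 1 ≤ n)
  have hlog : 0 < Real.log n := Real.log_pos (by exact_mod_cast (by omega : 1 < n))
  have hll : 1 ≤ Real.log (Real.log n) := by
    have := Real.one_le_exp (x := 81) (by norm_num)
    linarith
  have h5 : (n : ℝ) ^ ((2 : ℝ) / 5) ≤ (n : ℝ) ^ ((2 : ℝ) / 3) :=
    Real.rpow_le_rpow_of_exponent_le hn1 (by norm_num)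
  have h6 : 1 ≤ (n : ℝ) ^ ((2 : ℝ) / 3) := Real.one_le_rpow hn1 (by norm_num)
  have h7 : (n : ℝ) ^ ((2 : ℝ) / 3) * (n : ℝ) ^ ((1 : ℝ) / 3) = n := by
    rw [← Real.rpow_add (by linarith)]
    norm_num
  have h8 : eps n * n ≥ 1 / Real.log n * n := by
    unfold eps
    gcongr
  have h9 : 1 / Real.log n * n ≥ 5 * (n : ℝ) ^ ((2 : ℝ) / 3) := by
    rw [ge_iff_le, div_mul_eq_mul_div, one_mul, le_div_iff₀ hlog]
    calc _ = (n : ℝ) ^ ((2 : ℝ) / 3) * (5 * Real.log n) := by ring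
      _ ≤ (n : ℝ) ^ ((2 : ℝ) / 3) * (n : ℝ) ^ ((1 : ℝ) / 3) := by gcongr
      _ = n := h7
  linarith

lemma lt_numEdges (n : ℕ) : n * (Real.log n - Real.log (Real.log n)) - 1 < numEdges n :=
  Nat.sub_one_lt_floor _

lemma le_degreeBound (n : ℕ) : Real.log n / 20 ≤ degreeBound n := Nat.le_ceil _

lemma le_smallBound (n : ℕ) : (n : ℝ) ^ ((2 : ℝ) / 5) ≤ smallBound n := Nat.le_ceil _

lemma smallBound_lt (n : ℕ) : (smallBound n : ℝ) < (n : ℝ) ^ ((2 : ℝ) / 5) + 1 :=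
  Nat.ceil_lt_add_one (by positivity)

lemma lt_numTreeColours (n : ℕ) : 25 * eps n * n - 1 < numTreeColours n := Nat.sub_one_lt_floor _

lemma lt_numColours (n : ℕ) : (1 + 50 * eps n) * n - 1 < numColours n := Nat.sub_one_lt_floor _

lemma treeSize_lt (n : ℕ) : (⌈(n : ℝ) ^ ((2 : ℝ) / 3)⌉₊ : ℝ) < (n : ℝ) ^ ((2 : ℝ) / 3) + 1 :=
  Nat.ceil_lt_add_one (by positivity)

variable {n : ℕ}

namespace LargeEnough

lemma eight_le_logLog (h : LargeEnough n) : 8 ≤ Real.log (Real.log n) := by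
  have := Real.one_le_exp (x := 81) (by norm_num)
  have := h.logLog
  linarith

lemma log_pos (h : LargeEnough n) : 0 < Real.log n := by
  have h1 := h.eight_le_logLog
  by_contra! h2
  have h3 : Real.log n = 0 := le_antisymm h2 (Real.log_natCast_nonneg n)
  rw [h3, Real.log_zero] at h1
  linarith

lemma exp_logLog (h : LargeEnough n) : Real.exp (Real.log (Real.log n)) = Real.log n :=
  Real.exp_log h.log_pos

lemma nat_pos (h : LargeEnough n) : 0 < n := by
  rcases Nat.eq_zero_or_pos n with rfl | h'
  · simpa using h.log_pos
  · exact h'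

lemma cast_pos (h : LargeEnough n) : (0 : ℝ) < n := by exact_mod_cast h.nat_pos

lemma exp_log (h : LargeEnough n) : Real.exp (Real.log n) = n := Real.exp_log h.cast_pos

lemma eps_mul_log (h : LargeEnough n) : eps n * Real.log n = Real.log (Real.log n) :=
  div_mul_cancel₀ _ h.log_pos.ne'

lemma eps_pos (h : LargeEnough n) : 0 < eps n := div_pos (by linarith [h.eight_le_logLog]) h.log_pos

lemma eps_le_hundredth (h : LargeEnough n) : eps n ≤ 1 / 100 := by
  have := Real.exp_le_one_iff.2 (show (-81 : ℝ) ≤ 0 by norm_num)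
  have := h.eps_le
  linarith

lemma logLog_le (h : LargeEnough n) : Real.log (Real.log n) ≤ Real.log n / 100 := by
  rw [← h.eps_mul_log]
  have := mul_le_mul_of_nonneg_right h.eps_le_hundredth h.log_pos.le
  linarith

lemma log_ge (h : LargeEnough n) : 800 ≤ Real.log n := by
  have := h.logLog_le
  have := h.eight_le_logLog
  linarith

lemma thousand_le (h : LargeEnough n) : (1000 : ℝ) ≤ n := by
  have := h.logSq
  have := h.log_ge
  nlinarith

lemma thousand_le_nat (h : LargeEnough n) : 1000 ≤ n := by exact_mod_cast h.thousand_le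

lemma cast_pred (h : LargeEnough n) : ((n - 1 : ℕ) : ℝ) = n - 1 := by
  rw [Nat.cast_sub (by have := h.nat_pos; omega), Nat.cast_one]

lemma numEdges_le (h : LargeEnough n) :
    (numEdges n : ℝ) ≤ n * (Real.log n - Real.log (Real.log n)) :=
  Nat.floor_le (mul_nonneg h.cast_pos.le (by linarith [h.logLog_le, h.log_pos]))

lemma numEdges_div_le (h : LargeEnough n) :
    (numEdges n : ℝ) / (n * (n - 1) : ℕ) ≤ 2 * Real.log n / n := by
  have h1 := h.numEdges_le
  have h2 := h.thousand_le
  have h3 := h.eight_le_logLog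
  have h4 := h.log_pos
  rw [nat_cast_mul_pred, div_le_div_iff₀ (by nlinarith) h.cast_pos]
  have h5 : (numEdges n : ℝ) ≤ n * Real.log n := by nlinarith
  have h6 : 0 ≤ n * Real.log n := by positivity
  nlinarith

lemma numEdges_add_le (h : LargeEnough n) : numEdges n + 2 * (n - 1) ≤ n * (n - 1) := by
  have h1 := h.numEdges_le
  have h2 := h.thousand_le
  have h3 := h.eight_le_logLog
  have h4 := h.log_ge
  have h5 := h.logSq
  have : ((numEdges n + 2 * (n - 1) : ℕ) : ℝ) ≤ ((n * (n - 1) : ℕ) : ℝ) := by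
    rw [nat_cast_mul_pred]
    push_cast
    rw [h.cast_pred]
    have h6 : Real.log n ≤ n / 9600 := by nlinarith
    nlinarith
  exact_mod_cast this

lemma degreeBound_lt (h : LargeEnough n) : (degreeBound n : ℝ) < Real.log n / 20 + 1 :=
  Nat.ceil_lt_add_one (by have := h.log_pos; positivity)

lemma rpow_eq (h : LargeEnough n) (x : ℝ) : (n : ℝ) ^ x = Real.exp (Real.log n * x) :=
  Real.rpow_def_of_pos h.cast_pos x

lemma one_le_rpow (h : LargeEnough n) {x : ℝ} (hx : 0 ≤ x) : 1 ≤ (n : ℝ) ^ x :=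
  Real.one_le_rpow (by linarith [h.thousand_le]) hx

lemma numTreeColours_le (h : LargeEnough n) : (numTreeColours n : ℝ) ≤ 25 * eps n * n :=
  Nat.floor_le (by have := h.eps_pos; positivity)

lemma numColours_le (h : LargeEnough n) : (numColours n : ℝ) ≤ (1 + 50 * eps n) * n :=
  Nat.floor_le (by have := h.eps_pos; positivity)

lemma numColours_le_two_mul (h : LargeEnough n) : (numColours n : ℝ) ≤ 2 * n := by
  have := h.numColours_le
  have := mul_le_mul_of_nonneg_right h.eps_le_hundredth h.cast_pos.le
  linarith

lemma treeSize_add_smallBound_le (h : LargeEnough n) :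
    (⌈(n : ℝ) ^ ((2 : ℝ) / 3)⌉₊ : ℝ) + smallBound n + 1 ≤ eps n * n := by
  have := h.root
  have := treeSize_lt n
  have := smallBound_lt n
  linarith

lemma smallBound_add_one_le (h : LargeEnough n) : (smallBound n : ℝ) + 1 ≤ eps n * n := by
  have := h.treeSize_add_smallBound_le
  have : (0 : ℝ) ≤ (⌈(n : ℝ) ^ ((2 : ℝ) / 3)⌉₊ : ℝ) := Nat.cast_nonneg _
  linarith

lemma treeSize_le (h : LargeEnough n) : (⌈(n : ℝ) ^ ((2 : ℝ) / 3)⌉₊ : ℝ) ≤ n / 100 := by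
  have h1 := h.treeSize_add_smallBound_le
  have h2 := mul_le_mul_of_nonneg_right h.eps_le_hundredth h.cast_pos.le
  have : (0 : ℝ) ≤ smallBound n := Nat.cast_nonneg _
  linarith

lemma colours_enough (h : LargeEnough n) : numTreeColours n + smallBound n + n ≤ numColours n := by
  have h1 := h.numTreeColours_le
  have h2 := h.smallBound_add_one_le
  have h3 := lt_numColours n
  have h4 := mul_pos h.eps_pos h.cast_pos
  have : ((numTreeColours n + smallBound n + n : ℕ) : ℝ) ≤ numColours n := by
    push_cast
    nlinarith
  exact_mod_cast this

lemma cast_le_numColours (h : LargeEnough n) : (n : ℝ) ≤ numColours n := by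
  have := h.colours_enough
  exact_mod_cast (by omega : n ≤ numColours n)

end LargeEnough

end Asymptotics

section Estimates

variable {n : ℕ}

namespace LargeEnough

lemma sub_logLog_le_div (h : LargeEnough n) :
    Real.log n - Real.log (Real.log n) - 1 ≤ numEdges n / n := by
  have h1 := lt_numEdges n
  have h2 := h.thousand_le
  rw [le_div_iff₀ h.cast_pos]
  linarith

lemma log_div_three_le_meanZero (h : LargeEnough n) :
    Real.log n / 3 ≤ meanZero n (numEdges n) := by
  have hm := h.numEdges_le
  have hn := h.thousand_le
  have hL := h.log_ge
  have hll := h.logLog_le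
  have hl8 := h.eight_le_logLog
  have hsq := h.logSq
  set a := Real.log n - Real.log (Real.log n) with ha
  have ha0 : 700 ≤ a := by linarith
  have haL : a ≤ Real.log n := by linarith
  have ha2 : 12 * a ^ 2 ≤ n := by nlinarith
  set P : ℝ := (n : ℝ) - 1 with hP
  have hnP : (n : ℝ) = P + 1 := by simp [hP]
  have hP0 : 0 < P := by linarith
  have hkey : (numEdges n : ℝ) * (P + (a + 1)) ≤ (a + 1) * P ^ 2 := by
    have h1 : (numEdges n : ℝ) * (P + (a + 1)) ≤ (P + 1) * a * (P + (a + 1)) := by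
      rw [← hnP]
      gcongr
    have h2 : 12 * a ^ 2 ≤ P + 1 := by linarith
    have h3 : a * (a + 2) * P ≤ (P / 2) * P := by
      gcongr
      nlinarith
    have h4 : a * (a + 1) ≤ P / 2 * P := by nlinarith
    nlinarith
  have hmP : (numEdges n : ℝ) < P ^ 2 := by
    have : (0 : ℝ) ≤ numEdges n := Nat.cast_nonneg _
    nlinarith
  have hx1 : 0 < 1 - numEdges n / P ^ 2 := by
    rw [sub_pos, div_lt_one (by positivity)]
    exact hmP
  have hlog := Real.one_sub_inv_le_log_of_pos hx1
  have hmul : -(a + 1) ≤ P * Real.log (1 - numEdges n / P ^ 2) := by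
    refine le_trans ?_ (mul_le_mul_of_nonneg_left hlog hP0.le)
    have h1 : (1 - numEdges n / P ^ 2)⁻¹ = P ^ 2 / (P ^ 2 - numEdges n) := by
      have : P ^ 2 - numEdges n ≠ 0 := by linarith
      field_simp
    have h2 : P * (1 - P ^ 2 / (P ^ 2 - numEdges n)) =
        -(P * numEdges n / (P ^ 2 - numEdges n)) := by
      have : P ^ 2 - numEdges n ≠ 0 := by linarith
      field_simp
      ring
    rw [h1, h2, neg_le_neg_iff, div_le_iff₀ (by linarith)]
    linarith
  have hpow : Real.exp (-(a + 1)) ≤ (1 - numEdges n / P ^ 2) ^ (n - 1) := by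
    rw [← Real.exp_log hx1, ← Real.exp_nat_mul, h.cast_pred, Real.exp_le_exp]
    exact hmul
  refine le_trans ?_ (le_meanZero (by have := h.thousand_le_nat; omega) hmP.le)
  calc Real.log n / 3 ≤ Real.log n * Real.exp (-1) := by
        rw [div_eq_mul_inv, Real.exp_neg]
        have := h.log_pos.le
        gcongr
        linarith [Real.exp_one_lt_d9]
    _ = n * Real.exp (-(a + 1)) := by
        nth_rewrite 1 [← h.exp_logLog]
        nth_rewrite 2 [← h.exp_log]
        rw [← Real.exp_add, ← Real.exp_add, ha]
        congr 1
        ring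
    _ ≤ _ := by gcongr

lemma meanZero_div_le (h : LargeEnough n) :
    meanZero n (numEdges n) / (meanZero n (numEdges n) - 1) ^ 2 ≤ 12 / Real.log n := by
  have h1 := h.log_div_three_le_meanZero
  have h2 := h.log_ge
  set μ := meanZero n (numEdges n)
  rw [div_le_div_iff₀ (by nlinarith) (by linarith)]
  nlinarith

lemma four_pow_degreeBound_le (h : LargeEnough n) :
    (4 : ℝ) ^ degreeBound n ≤ 4 * Real.exp (7 / 100 * Real.log n) := by
  have h1 := h.degreeBound_lt
  have h2 := h.log_pos
  have h3 : Real.log 4 = 2 * Real.log 2 := by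
    rw [show (4 : ℝ) = 2 ^ 2 by norm_num, Real.log_pow]
    norm_num
  have h4 := Real.log_two_lt_d9
  have h5 := Real.log_two_gt_d9
  have h6 : (4 : ℝ) = Real.exp (Real.log 4) := (Real.exp_log (by norm_num)).symm
  rw [← Real.rpow_natCast, Real.rpow_def_of_pos (by norm_num)]
  nth_rewrite 2 [h6]
  rw [← Real.exp_add, Real.exp_le_exp, h3]
  nlinarith

lemma exists_small_degree_le (h : LargeEnough n) :
    (n * (4 ^ degreeBound n * Real.exp (-((numEdges n : ℝ) / (n * (n - 1) : ℕ) *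
      (3 / 4 * (n - 1 : ℕ)))))) / (smallBound n) ≤
      4 * Real.exp (1 - 7 / 100 * Real.log n) := by
  have hn := h.thousand_le
  have h1 := h.sub_logLog_le_div
  have h2 := h.logLog_le
  have h3 := h.four_pow_degreeBound_le
  have h4 := le_smallBound n
  rw [h.rpow_eq] at h4
  have h5 : (numEdges n : ℝ) / (n * (n - 1) : ℕ) * (3 / 4 * (n - 1 : ℕ)) =
      3 / 4 * (numEdges n / n) := by
    rw [nat_cast_mul_pred, h.cast_pred]
    have : (n : ℝ) - 1 ≠ 0 := by linarith
    field_simp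
  rw [h5, div_le_iff₀ (lt_of_lt_of_le (Real.exp_pos _) h4)]
  calc _ ≤ Real.exp (Real.log n) * (4 * Real.exp (7 / 100 * Real.log n) *
        Real.exp (-(3 / 4 * (Real.log n - Real.log (Real.log n) - 1)))) := by
        rw [h.exp_log]
        gcongr
    _ = 4 * Real.exp (Real.log n + 7 / 100 * Real.log n -
        3 / 4 * (Real.log n - Real.log (Real.log n) - 1)) := by
        rw [sub_eq_add_neg (_ + _), Real.exp_add, Real.exp_add]
        ring
    _ ≤ 4 * Real.exp ((1 - 7 / 100 * Real.log n) + Real.log n * (2 / 5)) := by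
        gcongr
        linarith [h.log_pos]
    _ ≤ _ := by
        rw [Real.exp_add, mul_assoc]
        gcongr

lemma adjacent_small_degree_le (h : LargeEnough n) :
    (n : ℝ) ^ 3 * (16 ^ degreeBound n * (((numEdges n : ℝ) / (n * (n - 1) : ℕ)) ^ 2 *
      Real.exp (-(((numEdges n : ℝ) - 2) / (n * (n - 1) : ℕ) *
        (3 / 4 * (2 * (n - 1 : ℕ) - 2)))))) ≤ 64 * Real.exp (2 - 3 / 10 * Real.log n) := by
  have hn := h.thousand_le
  have h2 := h.logLog_le
  have h3 := h.four_pow_degreeBound_le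
  have h8 := h.eight_le_logLog
  have hL := h.log_ge
  have hm := h.numEdges_le
  have hm' := lt_numEdges n
  have h16 : (16 : ℝ) ^ degreeBound n ≤ 16 * Real.exp (14 / 100 * Real.log n) := by
    calc (16 : ℝ) ^ degreeBound n = (4 ^ degreeBound n) ^ 2 := by
          rw [← pow_mul, mul_comm, pow_mul]
          norm_num
      _ ≤ (4 * Real.exp (7 / 100 * Real.log n)) ^ 2 := by gcongr
      _ = 16 * Real.exp (14 / 100 * Real.log n) := by
          rw [mul_pow, ← Real.exp_nat_mul]
          norm_num
          ring_nf
  have hexp : Real.log n - Real.log (Real.log n) - 1 ≤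
      ((numEdges n : ℝ) - 2) / (n * (n - 1)) * (n - 2) := by
    have hpos : 0 < (n : ℝ) * (n - 1) := by nlinarith
    rw [div_mul_eq_mul_div, le_div_iff₀ hpos]
    have hsq := h.logSq
    set a := Real.log n - Real.log (Real.log n)
    have ha : 700 ≤ a := by linarith
    have ha' : a ≤ Real.log n := by linarith
    have haL : 12 * a ≤ n := by nlinarith
    have : (n * a - 3) * (n - 2) ≤ ((numEdges n : ℝ) - 2) * (n - 2) :=
      mul_le_mul_of_nonneg_right (by linarith) (by linarith)
    nlinarith
  have h5 : ((numEdges n : ℝ) - 2) / (n * (n - 1) : ℕ) * (3 / 4 * (2 * (n - 1 : ℕ) - 2)) =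
      3 / 2 * (((numEdges n : ℝ) - 2) / (n * (n - 1)) * (n - 2)) := by
    rw [nat_cast_mul_pred, h.cast_pred]
    ring
  rw [h5]
  calc _ ≤ (n : ℝ) ^ 3 * (16 * Real.exp (14 / 100 * Real.log n) * ((2 * Real.log n / n) ^ 2 *
        Real.exp (-(3 / 2 * (Real.log n - Real.log (Real.log n) - 1))))) := by
        have := h.numEdges_div_le
        gcongr
    _ = 64 * ((n : ℝ) * Real.log n ^ 2 * Real.exp (14 / 100 * Real.log n) *
        Real.exp (-(3 / 2 * (Real.log n - Real.log (Real.log n) - 1)))) := by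
        have := h.cast_pos.ne'
        field_simp
        ring
    _ = 64 * Real.exp (Real.log n + 2 * Real.log (Real.log n) + 14 / 100 * Real.log n +
        -(3 / 2 * (Real.log n - Real.log (Real.log n) - 1))) := by
        rw [Real.exp_add, Real.exp_add, Real.exp_add, h.exp_log, two_mul, Real.exp_add,
          h.exp_logLog, sq]
    _ ≤ _ := by
        gcongr
        linarith

lemma smallBound_sq_div_le (h : LargeEnough n) :
    (smallBound n : ℝ) ^ 2 / numColours n ≤ 4 * Real.exp (-(1 / 5 * Real.log n)) := by
  have h1 := smallBound_lt n
  have h2 := h.one_le_rpow (x := 2 / 5) (by norm_num)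
  have h3 := h.cast_le_numColours
  have h4 := h.cast_pos
  rw [div_le_iff₀ (by linarith)]
  calc (smallBound n : ℝ) ^ 2 ≤ (2 * (n : ℝ) ^ ((2 : ℝ) / 5)) ^ 2 := by
        gcongr
        linarith
    _ = 4 * Real.exp (-(1 / 5 * Real.log n)) * n := by
        nth_rewrite 3 [← h.exp_log]
        rw [h.rpow_eq, mul_pow, ← Real.exp_nat_mul, mul_assoc, ← Real.exp_add]
        push_cast
        ring_nf
    _ ≤ _ := by gcongr

end LargeEnough

end Estimates

section TreeEstimate

variable {n : ℕ}

lemma choose_mul_pow_le (n t : ℕ) : (n.choose t : ℝ) * (t : ℝ) ^ t ≤ (n : ℝ) ^ t * Real.exp t := by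
  have h1 := Nat.choose_le_pow_div (α := ℝ) t n
  have h2 := Real.pow_div_factorial_le_exp (t : ℝ) (Nat.cast_nonneg t) t
  calc (n.choose t : ℝ) * (t : ℝ) ^ t ≤ (n : ℝ) ^ t / t.factorial * (t : ℝ) ^ t := by gcongr
    _ = (n : ℝ) ^ t * ((t : ℝ) ^ t / t.factorial) := by ring
    _ ≤ _ := by gcongr

lemma inv_pow_le_exp {ρ : ℝ} (hρ : 1 / 2 ≤ ρ) (t : ℕ) : ρ⁻¹ ^ t ≤ Real.exp t := by
  have h1 : ρ⁻¹ ≤ Real.exp 1 := by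
    have : ρ⁻¹ ≤ (1 / 2)⁻¹ := by gcongr
    have := Real.add_one_le_exp 1
    linarith
  calc ρ⁻¹ ^ t ≤ Real.exp 1 ^ t := by
        have : 0 < ρ := by linarith
        gcongr
    _ = _ := by rw [← Real.exp_nat_mul, mul_one]

namespace LargeEnough

lemma treeTerm_le (h : LargeEnough n) {ρ : ℝ} (hρ : 1 / 2 ≤ ρ) (hρ' : ρ ≤ 1 - 10 * eps n)
    {t : ℕ} (ht : 1 ≤ t) (htn : (t : ℝ) ≤ n / 100) :
    treeTerm n (numEdges n) ρ t ≤ Real.exp (-(3 * Real.log (Real.log n))) ^ t := by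
  have hn := h.thousand_le
  have hL := h.log_ge
  have hll := h.logLog_le
  have hl8 := h.eight_le_logLog
  have hm := lt_numEdges n
  have hε := h.eps_pos
  have hεL := h.eps_mul_log
  have hpos := h.cast_pos
  have ht1 : ((t - 1 : ℕ) : ℝ) = t - 1 := by rw [Nat.cast_sub ht, Nat.cast_one]
  have ht0 : (1 : ℝ) ≤ t := by exact_mod_cast ht
  have htn' : (t : ℝ) ≤ n := by linarith
  have hnt : ((t * (n - t) : ℕ) : ℝ) = t * (n - t) := by
    rw [Nat.cast_mul, Nat.cast_sub (by exact_mod_cast htn')]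
  have hpair : ((numEdges n : ℝ) / (n * (n - 1) : ℕ)) ^ (t - 1) ≤
      Real.exp ((t - 1) * (Real.log (Real.log n) - Real.log n + 1)) := by
    have h1 : (numEdges n : ℝ) / (n * (n - 1) : ℕ) ≤
        Real.exp (Real.log (Real.log n) - Real.log n + 1) := by
      refine h.numEdges_div_le.trans ?_
      rw [Real.exp_add, Real.exp_sub, h.exp_logLog, h.exp_log, mul_div_assoc, mul_comm]
      have := h.log_pos
      gcongr
      have := Real.add_one_le_exp 1
      linarith
    calc _ ≤ Real.exp (Real.log (Real.log n) - Real.log n + 1) ^ (t - 1) := by gcongr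
      _ = _ := by rw [← Real.exp_nat_mul, ht1]
  have hdeg : Real.log n - Real.log (Real.log n) - 1 ≤
      ((numEdges n : ℝ) - (t - 1)) / (n * (n - 1)) * (n - 1) := by
    have : ((numEdges n : ℝ) - (t - 1)) / (n * (n - 1)) * (n - 1) =
        ((numEdges n : ℝ) - (t - 1)) / n := by
      have : (n : ℝ) - 1 ≠ 0 := by linarith
      field_simp
    rw [this, le_div_iff₀ hpos]
    linarith
  have hcross : 5 * Real.log (Real.log n) * t ≤
      ((numEdges n : ℝ) - (t - 1)) / (n * (n - 1)) * ((1 - ρ) * (t * (n - t))) := by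
    have h1 : Real.log n / 2 ≤ ((numEdges n : ℝ) - (t - 1)) / (n * (n - 1)) * (n - t) := by
      rw [div_mul_eq_mul_div, le_div_iff₀ (by nlinarith)]
      have h2 : n * (9 / 10 * Real.log n) ≤ (numEdges n : ℝ) - (t - 1) := by nlinarith
      have h3 : 99 / 100 * (n : ℝ) ≤ n - t := by linarith
      calc Real.log n / 2 * (n * (n - 1)) ≤ Real.log n / 2 * (n * n) := by
            gcongr
            linarith
        _ ≤ n * (9 / 10 * Real.log n) * (99 / 100 * n) := by
            have : 0 ≤ Real.log n * (n * n) := by positivity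
            nlinarith
        _ ≤ _ := by
            have := mul_nonneg hpos.le (mul_nonneg (by norm_num : (0 : ℝ) ≤ 9 / 10) h.log_pos.le)
            have := this.trans h2
            gcongr
    calc 5 * Real.log (Real.log n) * t = Real.log n / 2 * (10 * eps n * t) := by
          rw [← hεL]
          ring
      _ ≤ ((numEdges n : ℝ) - (t - 1)) / (n * (n - 1)) * (n - t) * ((1 - ρ) * t) := by
          have : 0 ≤ Real.log n / 2 := by linarith
          gcongr
          · linarith
          · linarith
      _ = _ := by ring
  have hchoose : (n.choose t : ℝ) * (t * (t : ℝ) ^ (t - 1)) ≤ Real.exp (t * (Real.log n + 1)) := by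
    rw [mul_pow_sub_one (by omega)]
    refine (choose_mul_pow_le n t).trans (le_of_eq ?_)
    nth_rewrite 1 [← h.exp_log]
    rw [← Real.exp_nat_mul, ← Real.exp_add]
    congr 1
    ring
  unfold treeTerm
  rw [ht1, nat_cast_mul_pred, hnt, h.cast_pred] at *
  set X := ((numEdges n : ℝ) - (t - 1)) / (n * (n - 1)) with hX
  calc _ = (n.choose t : ℝ) * (t * (t : ℝ) ^ (t - 1)) * (ρ⁻¹ ^ t *
        (((numEdges n : ℝ) / (n * (n - 1))) ^ (t - 1) *
          Real.exp (-(X * ((n - 1) + (1 - ρ) * (t * (n - t))))))) := by ring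
    _ ≤ Real.exp (t * (Real.log n + 1)) * (Real.exp t *
        (Real.exp ((t - 1) * (Real.log (Real.log n) - Real.log n + 1)) *
          Real.exp (-((Real.log n - Real.log (Real.log n) - 1) +
            5 * Real.log (Real.log n) * t)))) := by
        have h1 : 0 ≤ (numEdges n : ℝ) / (n * (n - 1)) :=
          div_nonneg (Nat.cast_nonneg _) (by nlinarith)
        have h2 := inv_pow_le_exp hρ t
        have h3 : 0 < ρ := by linarith
        gcongr
        linarith
    _ = Real.exp (t * (3 - 4 * Real.log (Real.log n))) := by
        rw [← Real.exp_add, ← Real.exp_add, ← Real.exp_add]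
        congr 1
        ring
    _ ≤ _ := by
        rw [← Real.exp_nat_mul]
        gcongr
        linarith

lemma sum_treeTerm_le (h : LargeEnough n) {ρ : ℝ} (hρ : 1 / 2 ≤ ρ) (hρ' : ρ ≤ 1 - 10 * eps n) :
    ∑ t ∈ Finset.Ico 1 ⌈(n : ℝ) ^ ((2 : ℝ) / 3)⌉₊, treeTerm n (numEdges n) ρ t ≤
      2 * Real.exp (-(3 * Real.log (Real.log n))) := by
  set r := Real.exp (-(3 * Real.log (Real.log n))) with hr
  have hr0 : 0 < r := Real.exp_pos _
  have hr1 : r ≤ 1 / 2 := by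
    have h1 := Real.add_one_le_exp (3 * Real.log (Real.log n))
    have h2 := h.eight_le_logLog
    rw [hr, Real.exp_neg, one_div]
    gcongr
    linarith
  calc _ ≤ ∑ t ∈ Finset.Ico 1 ⌈(n : ℝ) ^ ((2 : ℝ) / 3)⌉₊, r ^ t := by
        refine Finset.sum_le_sum fun t ht => ?_
        rw [Finset.mem_Ico] at ht
        refine h.treeTerm_le hρ hρ' ht.1 (le_trans ?_ h.treeSize_le)
        exact_mod_cast ht.2.le
    _ ≤ r ^ 1 / (1 - r) := geom_sum_Ico_le_of_lt_one hr0.le (by linarith)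
    _ ≤ 2 * r := by
        rw [div_le_iff₀ (by linarith)]
        nlinarith

lemma hallTerm_le (h : LargeEnough n) {s : ℕ} (hs : 1 ≤ s) (hsn : s ≤ n) :
    hallTerm n (numColours n) (numTreeColours n + smallBound n) (degreeBound n) s ≤
      2 / (n : ℝ) ^ 2 := by
  have hn := h.thousand_le
  have hpos := h.cast_pos
  have hw := h.cast_le_numColours
  have hw2 := h.numColours_le_two_mul
  have hw3 := lt_numColours n
  have hw0 : (0 : ℝ) < numColours n := by linarith
  have hε := h.eps_pos
  have hεn := h.smallBound_add_one_le
  have htc := h.numTreeColours_le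
  have hK := le_degreeBound n
  have hsn' : (s : ℝ) ≤ n := by exact_mod_cast hsn
  have hs' : (1 : ℝ) ≤ s := by exact_mod_cast hs
  have hL := h.log_ge
  have hδ : 0 < Real.exp (-81) := Real.exp_pos _
  have hq0 : (0 : ℝ) ≤ smallBound n := Nat.cast_nonneg _
  unfold hallTerm
  set y : ℝ := ((numTreeColours n + smallBound n + s : ℕ) : ℝ) / numColours n with hy
  have hy0 : 0 ≤ y := by positivity
  by_cases hcase : (s : ℝ) ≤ Real.exp (-81) * n
  · have hy1 : y ≤ Real.exp (-80) := by
      rw [hy, div_le_iff₀ hw0]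
      have h1 : 2 * Real.exp (-81) ≤ Real.exp (-80) := by
        rw [show (-80 : ℝ) = 1 + -81 by norm_num, Real.exp_add]
        have := Real.add_one_le_exp 1
        gcongr
        linarith
      have h2 : eps n * n ≤ Real.exp (-81) / 100 * n := by
        gcongr
        exact h.eps_le
      have h3 : 0 < Real.exp (-81) * n := by positivity
      push_cast
      calc (numTreeColours n + smallBound n + s : ℝ) ≤ 2 * Real.exp (-81) * n := by linarith
        _ ≤ Real.exp (-80) * numColours n := by gcongr
    have hpow : y ^ (degreeBound n * s) ≤ (((n : ℝ) ^ 4)⁻¹) ^ s := by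
      rw [pow_mul]
      gcongr
      calc y ^ degreeBound n ≤ Real.exp (-80) ^ degreeBound n := by gcongr
        _ = Real.exp (degreeBound n * -80) := by rw [← Real.exp_nat_mul]
        _ ≤ Real.exp (-(4 * Real.log n)) := by
            gcongr
            linarith
        _ = _ := by
            nth_rewrite 2 [← h.exp_log]
            rw [Real.exp_neg, ← Real.exp_nat_mul]
            norm_num
    have hc1 : (n.choose s : ℝ) ≤ (n : ℝ) ^ s := by exact_mod_cast Nat.choose_le_pow n s
    have hc2 : ((numColours n).choose s : ℝ) ≤ (2 * n : ℝ) ^ s := by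
      calc ((numColours n).choose s : ℝ) ≤ (numColours n : ℝ) ^ s := by
            exact_mod_cast Nat.choose_le_pow _ s
        _ ≤ _ := by gcongr
    calc _ ≤ (n : ℝ) ^ s * ((2 * n : ℝ) ^ s * (((n : ℝ) ^ 4)⁻¹) ^ s) := by gcongr
      _ = (2 / (n : ℝ) ^ 2) ^ s := by
          rw [← mul_pow, ← mul_pow]
          congr 1
          field_simp
      _ ≤ (2 / (n : ℝ) ^ 2) ^ 1 := by
          refine pow_le_pow_of_le_one (by positivity) ?_ hs
          rw [div_le_one (by positivity)]
          nlinarith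
      _ = _ := pow_one _
  · push Not at hcase
    have hy1 : y ≤ Real.exp (-(10 * eps n)) := by
      have h1 : y ≤ 1 - 10 * eps n := by
        rw [hy, div_le_iff₀ hw0]
        push_cast
        have : eps n * numColours n ≤ eps n * (2 * n) := by gcongr
        nlinarith
      have h2 := Real.add_one_le_exp (-(10 * eps n))
      linarith
    have hpow : y ^ (degreeBound n * s) ≤ Real.exp (-(4 * n)) := by
      calc y ^ (degreeBound n * s) ≤ Real.exp (-(10 * eps n)) ^ (degreeBound n * s) := by gcongr
        _ = Real.exp (-(10 * (eps n * (degreeBound n * s)))) := by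
            rw [← Real.exp_nat_mul]
            push_cast
            ring_nf
        _ ≤ Real.exp (-(10 * (eps n * (Real.log n / 20 * (Real.exp (-81) * n))))) := by
            have := h.log_pos.le
            gcongr
        _ = Real.exp (-(1 / 2 * (Real.log (Real.log n) * Real.exp (-81)) * n)) := by
            rw [← h.eps_mul_log]
            ring_nf
        _ ≤ Real.exp (-(4 * n)) := by
            have h1 : 8 ≤ Real.log (Real.log n) * Real.exp (-81) := by
              calc (8 : ℝ) = 8 * Real.exp 81 * Real.exp (-81) := by
                    rw [mul_assoc, ← Real.exp_add]
                    norm_num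
                _ ≤ _ := by
                    gcongr
                    exact h.logLog
            gcongr
            linarith
    have htwo : ∀ k : ℕ, (2 : ℝ) ^ k ≤ Real.exp k := fun k => by
      rw [← mul_one (k : ℝ), Real.exp_nat_mul]
      have := Real.add_one_le_exp 1
      gcongr
      linarith
    have hc1 : (n.choose s : ℝ) ≤ Real.exp n := by
      refine le_trans ?_ (htwo n)
      exact_mod_cast Nat.choose_le_two_pow n s
    have hc2 : ((numColours n).choose s : ℝ) ≤ Real.exp (2 * n) := by
      refine le_trans ?_ ((htwo (numColours n)).trans (Real.exp_le_exp.2 hw2))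
      exact_mod_cast Nat.choose_le_two_pow _ s
    calc _ ≤ Real.exp n * (Real.exp (2 * n) * Real.exp (-(4 * n))) := by gcongr
      _ = (Real.exp n)⁻¹ := by
          rw [← Real.exp_add, ← Real.exp_add, ← Real.exp_neg]
          ring_nf
      _ ≤ ((n : ℝ) ^ 2 / 2)⁻¹ := by
          have := Real.quadratic_le_exp_of_nonneg hpos.le
          gcongr
          linarith
      _ = _ := inv_div _ _

lemma sum_hallTerm_le (h : LargeEnough n) :
    ∑ s ∈ Finset.Icc 1 n, hallTerm n (numColours n) (numTreeColours n + smallBound n)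
      (degreeBound n) s ≤ 2 / n := by
  have hpos := h.cast_pos
  calc _ ≤ ∑ s ∈ Finset.Icc 1 n, 2 / (n : ℝ) ^ 2 := by
        refine Finset.sum_le_sum fun s hs => ?_
        rw [Finset.mem_Icc] at hs
        exact h.hallTerm_le hs.1 hs.2
    _ = _ := by
        simp only [Finset.sum_const, Nat.card_Icc, Nat.add_sub_cancel, nsmul_eq_mul]
        field_simp

/-- The fraction of the colours that a tree of the prescribed size may fail to use. -/
lemma colourFraction_bounds (h : LargeEnough n) {b : ℕ}
    (hb : b = numColours n - numTreeColours n + ⌈(n : ℝ) ^ ((2 : ℝ) / 3)⌉₊ + smallBound n) :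
    1 / 2 ≤ (b : ℝ) / numColours n ∧ (b : ℝ) / numColours n ≤ 1 - 10 * eps n := by
  have hw := h.cast_le_numColours
  have hw2 := h.numColours_le_two_mul
  have hpos := h.cast_pos
  have hw0 : (0 : ℝ) < numColours n := by linarith
  have h1 := h.treeSize_add_smallBound_le
  have h2 := h.numTreeColours_le
  have h3 := lt_numTreeColours n
  have h4 := mul_le_mul_of_nonneg_right h.eps_le_hundredth hpos.le
  have hε := h.eps_pos
  have h5 : eps n * numColours n ≤ eps n * (2 * n) := by gcongr
  have hq0 : (0 : ℝ) ≤ smallBound n := Nat.cast_nonneg _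
  have ht0 : (0 : ℝ) ≤ (⌈(n : ℝ) ^ ((2 : ℝ) / 3)⌉₊ : ℝ) := Nat.cast_nonneg _
  have hcast : (b : ℝ) = numColours n - numTreeColours n +
      ⌈(n : ℝ) ^ ((2 : ℝ) / 3)⌉₊ + smallBound n := by
    have := h.colours_enough
    rw [hb, Nat.cast_add, Nat.cast_add, Nat.cast_sub (by omega)]
  rw [le_div_iff₀ hw0, div_le_iff₀ hw0, hcast]
  constructor <;> nlinarith

end LargeEnough

end TreeEstimate

section Conclusion

/-- An upper bound for the total probability of the exceptional events. -/
noncomputable def failureBound (n : ℕ) : ℝ :=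
  12 / Real.log n + 4 * Real.exp (1 - 7 / 100 * Real.log n) +
    64 * Real.exp (2 - 3 / 10 * Real.log n) + 4 * Real.exp (-(1 / 5 * Real.log n)) +
    2 * Real.exp (-(3 * Real.log (Real.log n))) + 2 / n

lemma tendsto_failureBound : Tendsto failureBound atTop (nhds 0) := by
  have hL := tendsto_log_natCast
  have hLL := Real.tendsto_log_atTop.comp hL
  have hexp : ∀ (C c d : ℝ) (f : ℕ → ℝ), 0 < c → Tendsto f atTop atTop →
      Tendsto (fun n => C * Real.exp (d - c * f n)) atTop (nhds 0) := by
    intro C c d f hc hf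
    rw [← mul_zero C]
    refine Tendsto.const_mul C (Real.tendsto_exp_atBot.comp ?_)
    exact tendsto_atBot_add_const_left _ d (tendsto_neg_atTop_atBot.comp (hf.const_mul_atTop hc))
  have h1 : Tendsto (fun n : ℕ => 12 / Real.log n) atTop (nhds 0) := hL.const_div_atTop 12
  have h2 := hexp 4 (7 / 100) 1 _ (by norm_num) hL
  have h3 := hexp 64 (3 / 10) 2 _ (by norm_num) hL
  have h4 := hexp 4 (1 / 5) 0 _ (by norm_num) hL
  have h5 := hexp 2 3 0 _ (by norm_num) hLL
  have h6 : Tendsto (fun n : ℕ => 2 / (n : ℝ)) atTop (nhds 0) :=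
    tendsto_natCast_atTop_atTop.const_div_atTop 2
  have := ((((h1.add h2).add h3).add h4).add h5).add h6
  unfold failureBound
  simpa [Function.comp_def] using this

namespace LargeEnough

variable {n : ℕ}

lemma le_prob (h : LargeEnough n) :
    1 - failureBound n ≤ prob (fun ω : SampleSpace n =>
        ∃ (T : Set (Colour n)) (u : Fin n) (f : Fin n → Colour n),
          T.ncard = n - 1 ∧
          Set.BijOn f {v : Fin n | v ≠ u} T ∧
          (∀ v : Fin n, v ≠ u → ∃ e : DEdge n,
            inProcess ω (hitTime n (ZEvent ω)) e ∧ e.val.2 = v ∧ ω.2 e = f v) ∧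
          ∃ A : Set (DEdge n),
            (∀ e ∈ A, inProcess ω (hitTime n (ZEvent ω)) e) ∧
            IsArborescenceRootedAt A u ∧
            Set.InjOn ω.2 A ∧
            (∀ e ∈ A, ω.2 e ∉ T) ∧
            ⌈(n : ℝ) ^ ((2 : ℝ) / 3)⌉₊
              ≤ ({u} ∪ {v : Fin n | ∃ e ∈ A, (e : DEdge n).val.2 = v}).ncard) := by
  have hn := h.thousand_le
  have hn' := h.thousand_le_nat
  have hL := h.log_ge
  have hll := h.logLog_le
  have hm : (n : ℝ) ≤ numEdges n := by
    have := lt_numEdges n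
    nlinarith
  have ht₀m : ⌈(n : ℝ) ^ ((2 : ℝ) / 3)⌉₊ ≤ numEdges n := by
    have := h.treeSize_le
    exact_mod_cast (by linarith : (⌈(n : ℝ) ^ ((2 : ℝ) / 3)⌉₊ : ℝ) ≤ numEdges n)
  have hm2 : 2 ≤ numEdges n := by
    have : n ≤ numEdges n := by exact_mod_cast hm
    omega
  have hμ := h.log_div_three_le_meanZero
  obtain ⟨b, hb⟩ : ∃ b, b = numColours n - numTreeColours n +
      ⌈(n : ℝ) ^ ((2 : ℝ) / 3)⌉₊ + smallBound n := ⟨_, rfl⟩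
  obtain ⟨hρ, hρ'⟩ := h.colourFraction_bounds hb
  have hbw : b ≤ numColours n := by
    have hw : (0 : ℝ) < numColours n := by linarith [h.cast_le_numColours]
    have : (b : ℝ) / numColours n ≤ 1 := by linarith [h.eps_pos]
    rw [div_le_one hw] at this
    exact_mod_cast this
  refine le_trans ?_ (le_prob_assignment_and_arborescence (by omega) h.numEdges_add_le hm2
    ht₀m (Nat.one_le_ceil_iff.2 (Real.rpow_pos_of_pos h.cast_pos _))
    (Nat.one_le_ceil_iff.2 (div_pos h.log_pos (by norm_num)) : 1 ≤ degreeBound n)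
    (Nat.one_le_ceil_iff.2 (Real.rpow_pos_of_pos h.cast_pos _) : 1 ≤ smallBound n)
    (by linarith) h.colours_enough hb.ge hbw)
  rw [failureBound]
  gcongr 1 - (?_ + ?_ + ?_ + ?_ + ?_ + ?_)
  · exact h.meanZero_div_le
  · exact h.exists_small_degree_le
  · exact h.adjacent_small_degree_le
  · exact h.smallBound_sq_div_le
  · exact h.sum_treeTerm_le hρ hρ'
  · exact h.sum_hallTerm_le

end LargeEnough

end Conclusion

/-- A.a.s. in `D(n, m_Z)` there exist a set `T` of `n - 1` colours,
a vertex `u`, and a bijection `f : V \ {u} → T` such that every `v ≠ u` has an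
in-edge of colour `f v`, and moreover `D(n, m_Z)` contains a rainbow arborescence
rooted at `u` with at least `⌈n^{2/3}⌉` vertices all of whose edge colours lie
outside `T`. -/
theorem aas_assignment_and_partial_rainbow_arborescence :
    Tendsto
      (fun n : ℕ => prob (fun ω : SampleSpace n =>
        ∃ (T : Set (Colour n)) (u : Fin n) (f : Fin n → Colour n),
          T.ncard = n - 1 ∧
          Set.BijOn f {v : Fin n | v ≠ u} T ∧
          (∀ v : Fin n, v ≠ u → ∃ e : DEdge n,
            inProcess ω (hitTime n (ZEvent ω)) e ∧ e.val.2 = v ∧ ω.2 e = f v) ∧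
          ∃ A : Set (DEdge n),
            (∀ e ∈ A, inProcess ω (hitTime n (ZEvent ω)) e) ∧
            IsArborescenceRootedAt A u ∧
            Set.InjOn ω.2 A ∧
            (∀ e ∈ A, ω.2 e ∉ T) ∧
            ⌈(n : ℝ) ^ ((2 : ℝ) / 3)⌉₊
              ≤ ({u} ∪ {v : Fin n | ∃ e ∈ A, (e : DEdge n).val.2 = v}).ncard))
      atTop (nhds 1) := by
  refine tendsto_of_tendsto_of_tendsto_of_le_of_le' (g := fun n => 1 - failureBound n)
    (h := fun _ => 1) ?_ tendsto_const_nhds ?_ (Eventually.of_forall fun n => prob_le_one _)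
  · simpa using tendsto_failureBound.const_sub 1
  · filter_upwards [eventually_largeEnough] with n h
    exact h.le_prob
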